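/- arXiv:1910.04578 — 3 statements merged into one kernel-verified Lean document; each statement's English description precedes it below -/
import Mathlib

section
/- Let a < b be real numbers, T > 0 and m > 1. Suppose f : ℝ × ℝ → ℝ is positive on [a,b] × [0,T], the functions f, ∂_t f, ∂_x f and ∂_x(f^m), ∂_x²(f^m) exist and are continuous on [a,b] × [0,T], f satisfies the porous medium equation ∂_t f(x,t) = ∂_x²(f^m)(x,t) for all (x,t) ∈ [a,b] × (0,T), and the Neumann boundary condition ∂_x f(a,t) = ∂_x f(b,t) = 0 holds for all t ∈ (0,T). Define the velocity v(x,t) = −∂_x(f^m)(x,t) / f(x,t). Then for every t ∈ (0,T) the total energy E(t) = ∫_a^b f(x,t) · ln f(x,t) dx is differentiable in t and E'(t) = −∫_a^b ( f(x,t)^{2−m} / m ) · v(x,t)² dx; in particular E'(t) ≤ 0. -/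
/-- Differentiation under the integral sign over a compact interval, for an integrand which is
continuous together with its partial derivative on a rectangle. -/
theorem hasDerivAt_intervalIntegral_of_continuousOn_prod {a b c d t : ℝ} (hab : a ≤ b)
    (ht : t ∈ Set.Ioo c d) {F F' : ℝ × ℝ → ℝ}
    (hF : ContinuousOn F (Set.Icc a b ×ˢ Set.Icc c d))
    (hF' : ContinuousOn F' (Set.Icc a b ×ˢ Set.Icc c d))
    (hderiv : ∀ z ∈ Set.Icc a b, ∀ s ∈ Set.Ioo c d,
      HasDerivAt (fun s => F (z, s)) (F' (z, s)) s) :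
    HasDerivAt (fun s => ∫ z in a..b, F (z, s)) (∫ z in a..b, F' (z, t)) t := by
  obtain ⟨C, hC⟩ := (isCompact_Icc.prod isCompact_Icc).exists_bound_of_continuousOn hF'
  have hint : ∀ G : ℝ × ℝ → ℝ, ContinuousOn G (Set.Icc a b ×ˢ Set.Icc c d) →
      ∀ s ∈ Set.Ioo c d, IntervalIntegrable (fun z => G (z, s)) MeasureTheory.volume a b := by
    intro G hG s hs
    refine ContinuousOn.intervalIntegrable_of_Icc hab (hG.comp (by fun_prop) fun z hz => ?_)
    exact ⟨hz, Set.Ioo_subset_Icc_self hs⟩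
  have hnhds : Set.Ioo c d ∈ nhds t := Ioo_mem_nhds ht.1 ht.2
  have hIcc : ∀ z, z ∈ Set.uIoc a b → z ∈ Set.Icc a b := fun z hz =>
    Set.Ioc_subset_Icc_self (Set.uIoc_of_le hab ▸ hz)
  refine (intervalIntegral.hasDerivAt_integral_of_dominated_loc_of_deriv_le
    (F := fun s z => F (z, s)) (F' := fun s z => F' (z, s)) (bound := fun _ => C) hnhds ?_
    (hint F hF t ht) (hint F' hF' t ht).def'.aestronglyMeasurable ?_ (by simp) ?_).2
  · filter_upwards [hnhds] with s hs
    exact (hint F hF s hs).def'.aestronglyMeasurable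
  · exact .of_forall fun z hz s hs => hC (z, s) ⟨hIcc z hz, Set.Ioo_subset_Icc_self hs⟩
  · exact .of_forall fun z hz s hs => hderiv z (hIcc z hz) s hs

/-- Energy dissipation law for the porous medium equation `∂_t f = ∂_x²(f^m)`, `m > 1`,
on `[a,b] × [0,T]` with Neumann boundary conditions: with the velocity
`v = −∂_x(f^m)/f`, for every `t ∈ (0,T)` the total energy
`E(t) = ∫_a^b f ln f dx` is differentiable with
`E'(t) = −∫_a^b ( f^{2−m}/m ) v² dx ≤ 0`.
Here `ft = ∂_t f`, `fx = ∂_x f`, `fmx = ∂_x(f^m)`, `fmxx = ∂_x²(f^m)`. -/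
theorem stmt0 (a b T m : ℝ) (hab : a < b) (hT : 0 < T) (hm : 1 < m)
    (f ft fx fmx fmxx v : ℝ × ℝ → ℝ)
    (hf_pos : ∀ p ∈ Set.Icc a b ×ˢ Set.Icc 0 T, 0 < f p)
    (hft : ∀ p ∈ Set.Icc a b ×ˢ Set.Icc 0 T,
      HasDerivWithinAt (fun s => f (p.1, s)) (ft p) (Set.Icc 0 T) p.2)
    (hfx : ∀ p ∈ Set.Icc a b ×ˢ Set.Icc 0 T,
      HasDerivWithinAt (fun z => f (z, p.2)) (fx p) (Set.Icc a b) p.1)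
    (hfmx : ∀ p ∈ Set.Icc a b ×ˢ Set.Icc 0 T,
      HasDerivWithinAt (fun z => f (z, p.2) ^ m) (fmx p) (Set.Icc a b) p.1)
    (hfmxx : ∀ p ∈ Set.Icc a b ×ˢ Set.Icc 0 T,
      HasDerivWithinAt (fun z => fmx (z, p.2)) (fmxx p) (Set.Icc a b) p.1)
    (hf_cont : ContinuousOn f (Set.Icc a b ×ˢ Set.Icc 0 T))
    (hft_cont : ContinuousOn ft (Set.Icc a b ×ˢ Set.Icc 0 T))
    (hfx_cont : ContinuousOn fx (Set.Icc a b ×ˢ Set.Icc 0 T))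
    (hfmx_cont : ContinuousOn fmx (Set.Icc a b ×ˢ Set.Icc 0 T))
    (hfmxx_cont : ContinuousOn fmxx (Set.Icc a b ×ˢ Set.Icc 0 T))
    (hpme : ∀ p ∈ Set.Icc a b ×ˢ Set.Ioo 0 T, ft p = fmxx p)
    (hneumann : ∀ t ∈ Set.Ioo 0 T, fx (a, t) = 0 ∧ fx (b, t) = 0)
    (hv : ∀ p : ℝ × ℝ, v p = -fmx p / f p) :
    ∀ t ∈ Set.Ioo 0 T,
      HasDerivAt (fun s => ∫ z in a..b, f (z, s) * Real.log (f (z, s)))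
        (-∫ z in a..b, f (z, t) ^ (2 - m) / m * v (z, t) ^ 2) t ∧
      (-∫ z in a..b, f (z, t) ^ (2 - m) / m * v (z, t) ^ 2) ≤ 0 := by
  intro t ht
  have htI : t ∈ Set.Icc 0 T := Set.Ioo_subset_Icc_self ht
  have hslice : ∀ z ∈ Set.Icc a b, (z, t) ∈ Set.Icc a b ×ˢ Set.Icc 0 T := fun z hz => ⟨hz, htI⟩
  have hcont : ∀ G : ℝ × ℝ → ℝ, ContinuousOn G (Set.Icc a b ×ˢ Set.Icc 0 T) →
      ContinuousOn (fun z => G (z, t)) (Set.Icc a b) :=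
    fun G hG => hG.comp (by fun_prop) hslice
  have hlog_cont : ContinuousOn (fun p => Real.log (f p)) (Set.Icc a b ×ˢ Set.Icc 0 T) :=
    hf_cont.log fun p hp => (hf_pos p hp).ne'
  have hfmx_eq : ∀ z ∈ Set.Icc a b, fmx (z, t) = fx (z, t) * m * f (z, t) ^ (m - 1) := by
    intro z hz
    exact (uniqueDiffOn_Icc hab z hz).eq_deriv _ (hfmx _ (hslice z hz))
      ((hfx _ (hslice z hz)).rpow_const (Or.inl (hf_pos _ (hslice z hz)).ne'))
  have hleib := hasDerivAt_intervalIntegral_of_continuousOn_prod hab.le ht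
    (F := fun p => f p * Real.log (f p)) (F' := fun p => (Real.log (f p) + 1) * ft p)
    (hf_cont.mul hlog_cont) ((hlog_cont.add continuousOn_const).mul hft_cont) (by
      intro z hz s hs
      have hp : (z, s) ∈ Set.Icc a b ×ˢ Set.Icc 0 T := ⟨hz, Set.Ioo_subset_Icc_self hs⟩
      have hd : HasDerivAt (fun s => f (z, s)) (ft (z, s)) s :=
        (hft _ hp).hasDerivAt (Icc_mem_nhds hs.1 hs.2)
      exact (Real.hasDerivAt_mul_log (hf_pos _ hp).ne').comp s hd)
  have hparts : ∫ z in a..b, (Real.log (f (z, t)) + 1) * ft (z, t) =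
      -∫ z in a..b, f (z, t) ^ (2 - m) / m * v (z, t) ^ 2 := by
    have hpme_int : ∫ z in a..b, (Real.log (f (z, t)) + 1) * ft (z, t) =
        ∫ z in a..b, (Real.log (f (z, t)) + 1) * fmxx (z, t) := by
      refine intervalIntegral.integral_congr fun z hz => ?_
      rw [Set.uIcc_of_le hab.le] at hz
      simp only [hpme (z, t) ⟨hz, ht⟩]
    have hdiss : ∫ z in a..b, fx (z, t) / f (z, t) * fmx (z, t) =
        ∫ z in a..b, f (z, t) ^ (2 - m) / m * v (z, t) ^ 2 := by
      refine intervalIntegral.integral_congr fun z hz => ?_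
      rw [Set.uIcc_of_le hab.le] at hz
      have hpos := hf_pos _ (hslice z hz)
      have hm0 : m ≠ 0 := by positivity
      have hpow : f (z, t) ^ (2 - m) * f (z, t) ^ (m - 1) = f (z, t) := by
        rw [← Real.rpow_add hpos]
        norm_num
      simp only [hv, hfmx_eq z hz]
      field_simp
      linear_combination (-fx (z, t) ^ 2) * hpow
    rw [hpme_int, intervalIntegral.integral_mul_deriv_eq_deriv_mul_of_hasDerivWithinAt
      (u' := fun z => fx (z, t) / f (z, t)) (v := fun z => fmx (z, t)), hdiss,
      hfmx_eq a (Set.left_mem_Icc.2 hab.le), hfmx_eq b (Set.right_mem_Icc.2 hab.le),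
      (hneumann t ht).1, (hneumann t ht).2]
    · simp
    · rw [Set.uIcc_of_le hab.le]
      exact fun z hz =>
        ((hfx _ (hslice z hz)).log (hf_pos _ (hslice z hz)).ne').add_const 1
    · rw [Set.uIcc_of_le hab.le]
      exact fun z hz => hfmxx _ (hslice z hz)
    · exact ((hcont fx hfx_cont).div (hcont f hf_cont)
        fun z hz => (hf_pos _ (hslice z hz)).ne').intervalIntegrable_of_Icc hab.le
    · exact (hcont fmxx hfmxx_cont).intervalIntegrable_of_Icc hab.le
  refine ⟨hparts ▸ hleib, neg_nonpos.2 (intervalIntegral.integral_nonneg hab.le fun z hz => ?_)⟩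
  have hpos := hf_pos _ (hslice z hz)
  positivity
end

section
/- Fix m > 1, T > 0, real endpoints A < B, ratio constants c₂ ≥ c₁ > 0, and positive constants b_f ≤ B_f, δ₀, C*, C*_t, C̃*_t, C_e. Then there exist constants γ > 0 and σ₀ > 0, depending only on these data, with the following property. Let M ≥ 2 be an integer, h = (B−A)/M, and τ > 0 with c₁ τ ≤ h ≤ c₂ τ and τ, h ≤ σ₀; let N be an integer with N τ ≤ T; let X_i = A + i h and X_{i+1/2} = A + (i+½) h; and let f₀ : [A,B] → ℝ satisfy b_f ≤ f₀ ≤ B_f. Suppose: (i) x⁰, x¹, …, x^N ∈ Q are grid functions satisfying, for every n = 0,…,N−1 and 1 ≤ i ≤ M−1, ( f₀(X_i) / ( m ( f₀(X_i) / (D̃_h xⁿ)_i )^{m−1} ) ) · ( x^{n+1}_i − xⁿ_i )/τ = − [ d_h( f₀(X_{·+1/2}) / D_h x^{n+1} ) ]_i; (ii) W⁰, W¹, …, W^N ∈ Q with W⁰ = x⁰ satisfy the same equations up to residuals rⁿ, i.e. ( f₀(X_i) / ( m ( f₀(X_i) / (D̃_h Wⁿ)_i )^{m−1} ) ) · ( W^{n+1}_i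 − Wⁿ_i )/τ = − [ d_h( f₀(X_{·+1/2}) / D_h W^{n+1} ) ]_i + rⁿ_i, with ‖rⁿ‖₂ ≤ C_e (τ³ + h⁴) for all n; (iii) for all n and all admissible indices: (D̃_h Wⁿ)_i ≥ δ₀, (D_h Wⁿ)_{i+1/2} ≥ δ₀, ‖D̃_h Wⁿ‖_∞ ≤ C*, ‖D_h Wⁿ‖_∞ ≤ C*, ‖(W^{n+1} − Wⁿ)/τ‖_∞ ≤ C*_t, and ‖(D̃_h Wⁿ − D̃_h W^{n−1})/τ‖_∞ ≤ C̃*_t for n ≥ 1. Then ‖ Wⁿ − xⁿ ‖₂ ≤ γ (τ³ + h⁴) for every 0 ≤ n ≤ N. -/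
/-- The discrete `L²` norm `‖l‖₂ = ( h( ½ l₀² + Σ_{i=1}^{M−1} l_i² + ½ l_M² ) )^{1/2}`. -/
noncomputable def norm2 (M : ℕ) (h : ℝ) (l : ℕ → ℝ) : ℝ :=
  Real.sqrt (h * (l 0 ^ 2 / 2 + ∑ i ∈ Finset.Ico 1 M, l i ^ 2 + l M ^ 2 / 2))

/-- Half-node difference operator `(D_h l)_{j+1/2} = (l_{j+1} − l_j)/h`. -/
noncomputable def Dh (h : ℝ) (l : ℕ → ℝ) (j : ℕ) : ℝ := (l (j + 1) - l j) / h

/-- Node difference operator `(d_h φ)_i = (φ_{i+1/2} − φ_{i−1/2})/h` on half-node data. -/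
noncomputable def dh (h : ℝ) (φ : ℕ → ℝ) (i : ℕ) : ℝ := (φ i - φ (i - 1)) / h

/-- Node-centered difference operator `D̃_h`: central differences at interior nodes,
one-sided second-order differences at the boundary nodes. -/
noncomputable def Dtil (M : ℕ) (h : ℝ) (l : ℕ → ℝ) (i : ℕ) : ℝ :=
  if i = 0 then (4 * l 1 - l 2 - 3 * l 0) / (2 * h)
  else if i = M then (l (M - 2) - 4 * l (M - 1) + 3 * l M) / (2 * h)
  else (l (i + 1) - l (i - 1)) / (2 * h)

/-- Mobility coefficient `f / (m (f / D)^{m-1})` multiplying the discrete velocity. -/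
noncomputable def mobility (m f D : ℝ) : ℝ := f / (m * (f / D) ^ (m - 1))

lemma mobility_eq {m f D : ℝ} (hf : 0 < f) (hD : 0 < D) :
    mobility m f D = f / m * (D / f) ^ (m - 1) := by
  have h1 : (D / f) ^ (m - 1) = ((f / D) ^ (m - 1))⁻¹ := by
    rw [← Real.inv_rpow (by positivity), inv_div]
  rw [mobility, h1, ← div_eq_mul_inv, div_div]

lemma exists_lipschitz_rpow (p s₁ s₂ : ℝ) (hs₁ : 0 < s₁) :
    ∃ K > 0, ∀ s ∈ Set.Icc s₁ s₂, ∀ t ∈ Set.Icc s₁ s₂,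
      |t ^ p - s ^ p| ≤ K * |t - s| := by
  have hd : ∀ s ∈ Set.Icc s₁ s₂, HasDerivAt (fun s : ℝ => s ^ p) (p * s ^ (p - 1)) s :=
    fun s hs => Real.hasDerivAt_rpow_const (Or.inl (hs₁.trans_le hs.1).ne')
  have hc : ContinuousOn (fun s : ℝ => p * s ^ (p - 1)) (Set.Icc s₁ s₂) := fun s hs =>
    (continuousAt_const.mul
      (Real.continuousAt_rpow_const _ _ (Or.inl (hs₁.trans_le hs.1).ne'))).continuousWithinAt
  obtain ⟨K, hK⟩ := isCompact_Icc.exists_bound_of_continuousOn hc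
  refine ⟨max K 1, by positivity, fun s hs t ht => ?_⟩
  exact (convex_Icc s₁ s₂).norm_image_sub_le_of_norm_hasDerivWithin_le
    (fun u hu => (hd u hu).hasDerivWithinAt)
    (fun u hu => (hK u hu).trans (le_max_left _ _)) hs ht

lemma exists_mobility_bounds (m b b' d d' : ℝ) (hm : 1 < m) (hb : 0 < b) (hbb : b ≤ b')
    (hd : 0 < d) (hdd : d ≤ d') :
    ∃ α > 0, ∃ β > 0, ∃ L > 0, ∀ f ∈ Set.Icc b b', ∀ D ∈ Set.Icc d d',
      α ≤ mobility m f D ∧ mobility m f D ≤ β ∧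
      ∀ D' ∈ Set.Icc d d', |mobility m f D - mobility m f D'| ≤ L * |D - D'| := by
  have hb' : 0 < b' := hb.trans_le hbb
  have hd' : 0 < d' := hd.trans_le hdd
  have hm0 : 0 < m := by linarith
  obtain ⟨K, hK, hlip⟩ := exists_lipschitz_rpow (m - 1) (d / b') (d' / b) (by positivity)
  refine ⟨b / m * (d / b') ^ (m - 1), by positivity, b' / m * (d' / b) ^ (m - 1), by positivity,
    K / m, by positivity, fun f hf D hD => ?_⟩
  have hf0 : 0 < f := hb.trans_le hf.1
  have hmem : ∀ D ∈ Set.Icc d d', D / f ∈ Set.Icc (d / b') (d' / b) := fun D hD =>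
    ⟨div_le_div₀ (hd.le.trans hD.1) hD.1 hf0 hf.2, div_le_div₀ hd'.le hD.2 hb hf.1⟩
  have hD0 : 0 < D := hd.trans_le hD.1
  refine ⟨?_, ?_, fun D' hD' => ?_⟩
  · rw [mobility_eq hf0 hD0]
    have := Real.rpow_le_rpow (by positivity) (hmem D hD).1 (by linarith : 0 ≤ m - 1)
    have := hf.1
    gcongr
  · rw [mobility_eq hf0 hD0]
    have := Real.rpow_le_rpow (by positivity) (hmem D hD).2 (by linarith : 0 ≤ m - 1)
    have := hf.2
    gcongr
  · have hD'0 : 0 < D' := hd.trans_le hD'.1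
    rw [mobility_eq hf0 hD0, mobility_eq hf0 hD'0, ← mul_sub, abs_mul,
      abs_of_pos (by positivity : 0 < f / m)]
    calc f / m * |(D / f) ^ (m - 1) - (D' / f) ^ (m - 1)|
        ≤ f / m * (K * |D / f - D' / f|) := by
          gcongr
          exact hlip _ (hmem D' hD') _ (hmem D hD)
      _ = K / m * |D - D'| := by
          rw [← sub_div, abs_div, abs_of_pos hf0]
          field_simp

lemma Dtil_interior {M i : ℕ} (h : ℝ) (l : ℕ → ℝ) (hi : 1 ≤ i) (hiM : i < M) :
    Dtil M h l i = (l (i + 1) - l (i - 1)) / (2 * h) := by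
  rw [Dtil, if_neg (by omega), if_neg (by omega)]

lemma Dtil_eq_average {M i : ℕ} (h : ℝ) (l : ℕ → ℝ) (hi : 1 ≤ i) (hiM : i < M) :
    Dtil M h l i = (Dh h l i + Dh h l (i - 1)) / 2 := by
  rw [Dtil_interior h l hi hiM, Dh, Dh, Nat.sub_add_cancel hi, ← add_div, div_div, mul_comm 2 h]
  congr 1
  ring

lemma Dtil_sub (M : ℕ) (h : ℝ) (u v : ℕ → ℝ) (i : ℕ) :
    Dtil M h (fun k => u k - v k) i = Dtil M h u i - Dtil M h v i := by
  unfold Dtil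
  split_ifs <;> ring

lemma Dh_sub (h : ℝ) (u v : ℕ → ℝ) (j : ℕ) :
    Dh h (fun k => u k - v k) j = Dh h u j - Dh h v j := by
  unfold Dh
  ring

lemma sq_Dtil_le {M i : ℕ} (h : ℝ) (l : ℕ → ℝ) (hi : 1 ≤ i) (hiM : i < M) :
    Dtil M h l i ^ 2 ≤ (Dh h l i ^ 2 + Dh h l (i - 1) ^ 2) / 2 := by
  rw [Dtil_eq_average h l hi hiM]
  nlinarith [sq_nonneg (Dh h l i - Dh h l (i - 1))]

lemma sum_sq_Dtil_le (M : ℕ) (h : ℝ) (l : ℕ → ℝ) :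
    ∑ i ∈ Finset.Ico 1 M, Dtil M h l i ^ 2 ≤ ∑ j ∈ Finset.range M, Dh h l j ^ 2 := by
  have h1 : ∑ i ∈ Finset.Ico 1 M, Dh h l i ^ 2 ≤ ∑ j ∈ Finset.range M, Dh h l j ^ 2 := by
    refine Finset.sum_le_sum_of_subset_of_nonneg ?_ fun _ _ _ => sq_nonneg _
    rw [Finset.range_eq_Ico]
    exact Finset.Ico_subset_Ico_left zero_le_one
  have h2 : ∑ i ∈ Finset.Ico 1 M, Dh h l (i - 1) ^ 2 ≤ ∑ j ∈ Finset.range M, Dh h l j ^ 2 := by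
    rw [Finset.sum_Ico_eq_sum_range]
    simp only [Nat.add_sub_cancel_left]
    exact Finset.sum_le_sum_of_subset_of_nonneg (Finset.range_mono (Nat.sub_le _ _))
      fun _ _ _ => sq_nonneg _
  calc ∑ i ∈ Finset.Ico 1 M, Dtil M h l i ^ 2
      ≤ ∑ i ∈ Finset.Ico 1 M, (Dh h l i ^ 2 + Dh h l (i - 1) ^ 2) / 2 :=
        Finset.sum_le_sum fun i hi =>
          sq_Dtil_le h l (Finset.mem_Ico.1 hi).1 (Finset.mem_Ico.1 hi).2
    _ = (∑ i ∈ Finset.Ico 1 M, Dh h l i ^ 2 + ∑ i ∈ Finset.Ico 1 M, Dh h l (i - 1) ^ 2) / 2 := by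
        rw [← Finset.sum_div, Finset.sum_add_distrib]
    _ ≤ _ := by linarith

lemma sq_Dh_le (h : ℝ) (l : ℕ → ℝ) (j : ℕ) :
    Dh h l j ^ 2 ≤ 2 * (l (j + 1) ^ 2 + l j ^ 2) / h ^ 2 := by
  rw [Dh, div_pow]
  gcongr
  nlinarith [sq_nonneg (l (j + 1) + l j)]

/-- Discrete inverse inequality for grid functions vanishing at the boundary. -/
lemma sum_sq_Dh_le {M : ℕ} (hM : 1 ≤ M) (h : ℝ) {l : ℕ → ℝ} (h0 : l 0 = 0) (hMl : l M = 0) :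
    ∑ j ∈ Finset.range M, Dh h l j ^ 2 ≤ 4 / h ^ 2 * ∑ i ∈ Finset.Ico 1 M, l i ^ 2 := by
  have h1 : ∑ j ∈ Finset.range M, l j ^ 2 = ∑ i ∈ Finset.Ico 1 M, l i ^ 2 := by
    rw [Finset.range_eq_Ico, Finset.sum_eq_sum_Ico_succ_bot (by omega)]
    simp [h0]
  have h2 : ∑ j ∈ Finset.range M, l (j + 1) ^ 2 = ∑ i ∈ Finset.Ico 1 M, l i ^ 2 := by
    have h3 := Finset.sum_range_succ (fun j => l j ^ 2) M
    have h4 := Finset.sum_range_succ' (fun j => l j ^ 2) M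
    simp only [h0, hMl] at h3 h4
    linarith
  calc ∑ j ∈ Finset.range M, Dh h l j ^ 2
      ≤ ∑ j ∈ Finset.range M, 2 * (l (j + 1) ^ 2 + l j ^ 2) / h ^ 2 :=
        Finset.sum_le_sum fun j _ => sq_Dh_le h l j
    _ = 4 / h ^ 2 * ∑ i ∈ Finset.Ico 1 M, l i ^ 2 := by
        rw [← Finset.sum_div, ← Finset.mul_sum, Finset.sum_add_distrib, h1, h2]
        ring

lemma sq_le_sum_interior {M : ℕ} {l : ℕ → ℝ} (h0 : l 0 = 0) (hMl : l M = 0) {i : ℕ}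
    (hi : i ≤ M) : l i ^ 2 ≤ ∑ k ∈ Finset.Ico 1 M, l k ^ 2 := by
  have hnn : 0 ≤ ∑ k ∈ Finset.Ico 1 M, l k ^ 2 := Finset.sum_nonneg fun _ _ => sq_nonneg _
  rcases Nat.eq_zero_or_pos i with rfl | hpos
  · simpa [h0] using hnn
  rcases hi.eq_or_lt with rfl | hlt
  · simpa [hMl] using hnn
  · exact Finset.single_le_sum (f := fun k => l k ^ 2) (fun _ _ => sq_nonneg _)
      (Finset.mem_Ico.2 ⟨hpos, hlt⟩)

/-- Passage from the discrete `L²` norm to the discrete `W^{1,∞}` seminorm. -/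
lemma sq_Dh_le_of_norm_le {M : ℕ} {h E : ℝ} (hh : 0 < h) {l : ℕ → ℝ} (h0 : l 0 = 0)
    (hMl : l M = 0) (hE : h * ∑ i ∈ Finset.Ico 1 M, l i ^ 2 ≤ E) {j : ℕ} (hj : j < M) :
    Dh h l j ^ 2 ≤ 4 * E / h ^ 3 := by
  have h1 := sq_le_sum_interior h0 hMl (show j + 1 ≤ M from hj)
  have h2 := sq_le_sum_interior h0 hMl hj.le
  calc Dh h l j ^ 2 ≤ 2 * (l (j + 1) ^ 2 + l j ^ 2) / h ^ 2 := sq_Dh_le h l j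
    _ ≤ 4 * (∑ i ∈ Finset.Ico 1 M, l i ^ 2) / h ^ 2 := by
        gcongr ?_ / _
        linarith
    _ = 4 * (h * ∑ i ∈ Finset.Ico 1 M, l i ^ 2) / h ^ 3 := by field_simp
    _ ≤ 4 * E / h ^ 3 := by gcongr

lemma sq_Dtil_le_of_norm_le {M : ℕ} {h E : ℝ} (hh : 0 < h) {l : ℕ → ℝ} (h0 : l 0 = 0)
    (hMl : l M = 0) (hE : h * ∑ i ∈ Finset.Ico 1 M, l i ^ 2 ≤ E) {i : ℕ} (hi : 1 ≤ i)
    (hiM : i < M) : Dtil M h l i ^ 2 ≤ 4 * E / h ^ 3 := by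
  have h1 := sq_Dh_le_of_norm_le hh h0 hMl hE hiM
  have h2 := sq_Dh_le_of_norm_le hh h0 hMl hE (show i - 1 < M by omega)
  linarith [sq_Dtil_le h l hi hiM]

/-- Summation by parts for grid functions vanishing at the boundary. -/
lemma sum_dh_mul {M : ℕ} (hM : 1 ≤ M) (h : ℝ) (φ : ℕ → ℝ) {l : ℕ → ℝ} (h0 : l 0 = 0)
    (hMl : l M = 0) :
    ∑ i ∈ Finset.Ico 1 M, dh h φ i * l i = -∑ j ∈ Finset.range M, φ j * Dh h l j := by
  have key : ∀ k : ℕ, ∑ j ∈ Finset.range (k + 1), φ j * Dh h l j =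
      φ k * l (k + 1) / h - ∑ i ∈ Finset.Ico 1 (k + 1), dh h φ i * l i := by
    intro k
    induction k with
    | zero => simp [Dh, h0, mul_div_assoc]
    | succ k ih =>
      rw [Finset.sum_range_succ, ih, Finset.sum_Ico_succ_top (by omega : 1 ≤ k + 1)]
      simp only [Dh, dh, Nat.add_sub_cancel]
      ring
  obtain ⟨k, rfl⟩ := Nat.exists_eq_add_of_le' hM
  rw [key, hMl]
  ring

/-- Energy inequality for one step of the linearized error equation. -/
lemma error_energy_le {M : ℕ} (hM : 1 ≤ M) {h τ c : ℝ} (hh : 0 < h) (hτ : 0 < τ)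
    {e e' p g r ψ : ℕ → ℝ} (h0 : e' 0 = 0) (hMe : e' M = 0)
    (heq : ∀ i ∈ Finset.Ico 1 M, p i * ((e' i - e i) / τ) = -dh h ψ i + r i - g i)
    (hψ : ∀ j < M, ψ j * Dh h e' j ≤ -(c * Dh h e' j ^ 2)) :
    h * ∑ i ∈ Finset.Ico 1 M, p i * (e' i - e i) * e' i +
        τ * (c * (h * ∑ j ∈ Finset.range M, Dh h e' j ^ 2)) ≤
      τ * (h * ∑ i ∈ Finset.Ico 1 M, (r i - g i) * e' i) := by
  have h1 : ∑ i ∈ Finset.Ico 1 M, p i * (e' i - e i) * e' i =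
      τ * (∑ j ∈ Finset.range M, ψ j * Dh h e' j + ∑ i ∈ Finset.Ico 1 M, (r i - g i) * e' i) := by
    rw [← neg_neg (∑ j ∈ Finset.range M, ψ j * Dh h e' j), ← sum_dh_mul hM h ψ h0 hMe,
      ← Finset.sum_neg_distrib, ← Finset.sum_add_distrib, Finset.mul_sum]
    refine Finset.sum_congr rfl fun i hi => ?_
    have h2 : p i * (e' i - e i) = τ * (-dh h ψ i + r i - g i) := by
      rw [← heq i hi]
      field_simp
    rw [h2]
    ring
  have h3 : ∑ j ∈ Finset.range M, ψ j * Dh h e' j ≤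
      -(c * ∑ j ∈ Finset.range M, Dh h e' j ^ 2) := by
    rw [Finset.mul_sum, ← Finset.sum_neg_distrib]
    exact Finset.sum_le_sum fun j hj => hψ j (Finset.mem_range.1 hj)
  rw [h1]
  have h4 := mul_le_mul_of_nonneg_left h3 (mul_pos hτ hh).le
  linarith

lemma mul_le_young {ε : ℝ} (hε : 0 < ε) (a b : ℝ) : a * b ≤ ε / 2 * b ^ 2 + a ^ 2 / (2 * ε) := by
  have : 0 ≤ (ε * b - a) ^ 2 / (2 * ε) := by positivity
  have h2 : (ε * b - a) ^ 2 / (2 * ε) = ε / 2 * b ^ 2 + a ^ 2 / (2 * ε) - a * b := by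
    field_simp
    ring
  linarith

/-- Rough stability estimate for one step, using only monotonicity of the elliptic part. -/
lemma rough_step {M : ℕ} (hM : 1 ≤ M) {h τ c₁ α β L : ℝ} (hh : 0 < h) (hτ : 0 < τ)
    (hτ1 : τ ≤ 1) (hc₁ : 0 < c₁) (hτh : c₁ * τ ≤ h) (hα : 0 < α)
    {e e' p g r ψ : ℕ → ℝ} (he0 : e 0 = 0) (heM : e M = 0) (h0 : e' 0 = 0) (hMe : e' M = 0)
    (heq : ∀ i ∈ Finset.Ico 1 M, p i * ((e' i - e i) / τ) = -dh h ψ i + r i - g i)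
    (hψ : ∀ j < M, ψ j * Dh h e' j ≤ 0)
    (hp : ∀ i ∈ Finset.Ico 1 M, α ≤ p i ∧ p i ≤ β)
    (hg : ∀ i ∈ Finset.Ico 1 M, g i ^ 2 ≤ L ^ 2 * Dtil M h e i ^ 2) :
    h * ∑ i ∈ Finset.Ico 1 M, e' i ^ 2 ≤
      4 / α ^ 2 * (β ^ 2 + 4 * L ^ 2 / c₁ ^ 2 + 1) *
        (h * ∑ i ∈ Finset.Ico 1 M, e i ^ 2 + h * ∑ i ∈ Finset.Ico 1 M, r i ^ 2) := by
  have hen := error_energy_le (c := 0) hM hh hτ h0 hMe heq (by simpa using hψ)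
  have hen' : ∑ i ∈ Finset.Ico 1 M, p i * (e' i - e i) * e' i ≤
      τ * ∑ i ∈ Finset.Ico 1 M, (r i - g i) * e' i := by
    refine le_of_mul_le_mul_left ?_ hh
    linarith
  have hpt : ∑ i ∈ Finset.Ico 1 M, (α * e' i ^ 2 - (3 * α / 4 * e' i ^ 2 +
      (β ^ 2 * e i ^ 2 + τ ^ 2 * r i ^ 2 + τ ^ 2 * (L ^ 2 * Dtil M h e i ^ 2)) / α)) ≤
      ∑ i ∈ Finset.Ico 1 M, (p i * (e' i - e i) * e' i - τ * ((r i - g i) * e' i)) := by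
    refine Finset.sum_le_sum fun i hi => ?_
    obtain ⟨hp1, hp2⟩ := hp i hi
    have y1 := mul_le_young (half_pos hα) (p i * e i) (e' i)
    have y2 := mul_le_young (half_pos hα) (τ * r i) (e' i)
    have y3 := mul_le_young (half_pos hα) (-(τ * g i)) (e' i)
    have z1 : (p i * e i) ^ 2 / (2 * (α / 2)) ≤ β ^ 2 * e i ^ 2 / α := by
      rw [mul_pow, mul_div_cancel₀ _ two_ne_zero]
      have : 0 ≤ p i := hα.le.trans hp1
      gcongr
    have z2 : (τ * r i) ^ 2 / (2 * (α / 2)) = τ ^ 2 * r i ^ 2 / α := by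
      rw [mul_pow, mul_div_cancel₀ _ two_ne_zero]
    have z3 : (-(τ * g i)) ^ 2 / (2 * (α / 2)) ≤ τ ^ 2 * (L ^ 2 * Dtil M h e i ^ 2) / α := by
      rw [neg_sq, mul_pow, mul_div_cancel₀ _ two_ne_zero]
      have := hg i hi
      gcongr
    have z4 := mul_le_mul_of_nonneg_right hp1 (sq_nonneg (e' i))
    rw [add_div, add_div]
    linarith
  simp only [Finset.sum_sub_distrib, Finset.sum_add_distrib, ← Finset.mul_sum,
    ← Finset.sum_div] at hpt
  have hDt := (sum_sq_Dtil_le M h e).trans (sum_sq_Dh_le hM h he0 heM)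
  set Se := ∑ i ∈ Finset.Ico 1 M, e i ^ 2 with hSe
  set Se' := ∑ i ∈ Finset.Ico 1 M, e' i ^ 2
  set Sr := ∑ i ∈ Finset.Ico 1 M, r i ^ 2 with hSr
  set D := ∑ i ∈ Finset.Ico 1 M, Dtil M h e i ^ 2
  have hSe0 : 0 ≤ Se := Finset.sum_nonneg fun _ _ => sq_nonneg _
  have hSr0 : 0 ≤ Sr := Finset.sum_nonneg fun _ _ => sq_nonneg _
  have hD : τ ^ 2 * (L ^ 2 * D) ≤ 4 * L ^ 2 / c₁ ^ 2 * Se := by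
    have hr : τ ^ 2 / h ^ 2 ≤ 1 / c₁ ^ 2 := by
      rw [div_le_div_iff₀ (by positivity) (by positivity)]
      have := pow_le_pow_left₀ (by positivity) hτh 2
      linarith [mul_pow c₁ τ 2]
    calc τ ^ 2 * (L ^ 2 * D) ≤ τ ^ 2 * (L ^ 2 * (4 / h ^ 2 * Se)) := by gcongr
      _ = τ ^ 2 / h ^ 2 * (4 * L ^ 2 * Se) := by ring
      _ ≤ 1 / c₁ ^ 2 * (4 * L ^ 2 * Se) := by gcongr
      _ = _ := by ring
  have hr : τ ^ 2 * Sr ≤ 1 * Sr := by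
    gcongr
    exact pow_le_one₀ hτ.le hτ1
  have hmain : α * Se' / 4 ≤ (β ^ 2 + 4 * L ^ 2 / c₁ ^ 2 + 1) * (Se + Sr) / α := by
    have : (β ^ 2 * Se + τ ^ 2 * Sr + τ ^ 2 * (L ^ 2 * D)) / α ≤
        (β ^ 2 + 4 * L ^ 2 / c₁ ^ 2 + 1) * (Se + Sr) / α := by
      gcongr
      have : 0 ≤ (β ^ 2 + 4 * L ^ 2 / c₁ ^ 2) * Sr := by positivity
      linarith
    linarith
  have : Se' ≤ 4 / α ^ 2 * (β ^ 2 + 4 * L ^ 2 / c₁ ^ 2 + 1) * (Se + Sr) := by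
    calc Se' = 4 / α * (α * Se' / 4) := by field_simp
      _ ≤ 4 / α * ((β ^ 2 + 4 * L ^ 2 / c₁ ^ 2 + 1) * (Se + Sr) / α) := by gcongr
      _ = _ := by field_simp
  calc h * Se' ≤ h * (4 / α ^ 2 * (β ^ 2 + 4 * L ^ 2 / c₁ ^ 2 + 1) * (Se + Sr)) := by gcongr
    _ = _ := by ring

/-- Weighted discrete energy of a grid function. -/
noncomputable def errorEnergy (M : ℕ) (h τ c : ℝ) (a e : ℕ → ℝ) : ℝ :=
  h * ∑ i ∈ Finset.Ico 1 M, a i * e i ^ 2 / 2 +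
    τ * (c / 2 * (h * ∑ j ∈ Finset.range M, Dh h e j ^ 2))

lemma norm_le_errorEnergy {M : ℕ} {h τ c α : ℝ} (hh : 0 < h) (hτ : 0 < τ) (hc : 0 < c)
    (hα : 0 < α) {a : ℕ → ℝ} (e : ℕ → ℝ) (ha : ∀ i ∈ Finset.Ico 1 M, α ≤ a i) :
    h * ∑ i ∈ Finset.Ico 1 M, e i ^ 2 ≤ 2 / α * errorEnergy M h τ c a e := by
  have h1 : α / 2 * ∑ i ∈ Finset.Ico 1 M, e i ^ 2 ≤ ∑ i ∈ Finset.Ico 1 M, a i * e i ^ 2 / 2 := by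
    rw [Finset.mul_sum]
    refine Finset.sum_le_sum fun i hi => ?_
    have := mul_le_mul_of_nonneg_right (ha i hi) (sq_nonneg (e i))
    linarith
  have h2 : 0 ≤ τ * (c / 2 * (h * ∑ j ∈ Finset.range M, Dh h e j ^ 2)) := by positivity
  calc h * ∑ i ∈ Finset.Ico 1 M, e i ^ 2
      = 2 / α * (h * (α / 2 * ∑ i ∈ Finset.Ico 1 M, e i ^ 2)) := by field_simp
    _ ≤ 2 / α * (h * ∑ i ∈ Finset.Ico 1 M, a i * e i ^ 2 / 2) := by gcongr
    _ ≤ 2 / α * errorEnergy M h τ c a e := by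
        unfold errorEnergy
        gcongr
        linarith

/-- Refined energy estimate for one step, using coercivity of the elliptic part. -/
lemma refined_step {M : ℕ} (hM : 1 ≤ M) {h τ c K L : ℝ} (hh : 0 < h) (hτ : 0 < τ)
    (hc : 0 < c) {e e' p a a' g r ψ : ℕ → ℝ} (h0 : e' 0 = 0) (hMe : e' M = 0)
    (heq : ∀ i ∈ Finset.Ico 1 M, p i * ((e' i - e i) / τ) = -dh h ψ i + r i - g i)
    (hψ : ∀ j < M, ψ j * Dh h e' j ≤ -(c * Dh h e' j ^ 2))
    (hp : ∀ i ∈ Finset.Ico 1 M, 0 ≤ p i)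
    (hpa : ∀ i ∈ Finset.Ico 1 M, p i ≤ a i + K * τ)
    (hpa' : ∀ i ∈ Finset.Ico 1 M, a' i ≤ p i + K * τ)
    (hg : ∀ i ∈ Finset.Ico 1 M, g i ^ 2 ≤ L ^ 2 * Dtil M h e i ^ 2) :
    errorEnergy M h τ c a' e' ≤ errorEnergy M h τ c a e +
      τ * ((K / 2 + 1 / 2 + L ^ 2 / (2 * c)) *
        (h * ∑ i ∈ Finset.Ico 1 M, e i ^ 2 + h * ∑ i ∈ Finset.Ico 1 M, e' i ^ 2)) +
      τ * (h * ∑ i ∈ Finset.Ico 1 M, r i ^ 2) := by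
  have hen := error_energy_le hM hh hτ h0 hMe heq hψ
  have hpt : ∑ i ∈ Finset.Ico 1 M, (a' i * e' i ^ 2 / 2 - a i * e i ^ 2 / 2
      - K * τ / 2 * e' i ^ 2 - K * τ / 2 * e i ^ 2) ≤
      ∑ i ∈ Finset.Ico 1 M, p i * (e' i - e i) * e' i := by
    refine Finset.sum_le_sum fun i hi => ?_
    have y1 := mul_nonneg (hp i hi) (sq_nonneg (e' i - e i))
    have y2 := mul_le_mul_of_nonneg_right (hpa i hi) (sq_nonneg (e i))
    have y3 := mul_le_mul_of_nonneg_right (hpa' i hi) (sq_nonneg (e' i))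
    linarith
  have hrhs : ∑ i ∈ Finset.Ico 1 M, (r i - g i) * e' i ≤
      ∑ i ∈ Finset.Ico 1 M, (1 / 2 * r i ^ 2 + (1 / 2 + L ^ 2 / (2 * c)) * e' i ^ 2 +
        c / 2 * Dtil M h e i ^ 2) := by
    refine Finset.sum_le_sum fun i hi => ?_
    have y1 := mul_le_young one_pos (r i) (e' i)
    have y2 : -(g i) * e' i ≤ c / 2 * Dtil M h e i ^ 2 + L ^ 2 / (2 * c) * e' i ^ 2 := by
      have h1 : -(g i) * e' i ≤ |L * Dtil M h e i| * |e' i| := by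
        refine (le_abs_self _).trans ?_
        rw [abs_mul, abs_neg]
        exact mul_le_mul_of_nonneg_right
          (sq_le_sq.1 ((hg i hi).trans_eq (mul_pow _ _ _).symm)) (abs_nonneg _)
      have h2 := mul_le_young hc (|L| * |e' i|) |Dtil M h e i|
      rw [mul_pow, sq_abs, sq_abs, sq_abs] at h2
      rw [abs_mul] at h1
      have h3 : L ^ 2 * e' i ^ 2 / (2 * c) = L ^ 2 / (2 * c) * e' i ^ 2 := by ring
      linarith
    linarith
  simp only [Finset.sum_sub_distrib, Finset.sum_add_distrib, ← Finset.mul_sum] at hpt hrhs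
  have hDt := sum_sq_Dtil_le M h e
  unfold errorEnergy
  have hSe0 : 0 ≤ ∑ i ∈ Finset.Ico 1 M, e i ^ 2 := Finset.sum_nonneg fun _ _ => sq_nonneg _
  have hSr0 : 0 ≤ ∑ i ∈ Finset.Ico 1 M, r i ^ 2 := Finset.sum_nonneg fun _ _ => sq_nonneg _
  set Se := ∑ i ∈ Finset.Ico 1 M, e i ^ 2
  set Se' := ∑ i ∈ Finset.Ico 1 M, e' i ^ 2
  set Sr := ∑ i ∈ Finset.Ico 1 M, r i ^ 2
  set D := ∑ i ∈ Finset.Ico 1 M, Dtil M h e i ^ 2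
  have z1 := mul_le_mul_of_nonneg_left hpt hh.le
  have z2 := mul_le_mul_of_nonneg_left hrhs (mul_pos hτ hh).le
  have z3 := mul_le_mul_of_nonneg_left hDt (by positivity : 0 ≤ τ * h * (c / 2))
  have z4 : 0 ≤ τ * h * (1 / 2 + L ^ 2 / (2 * c)) * Se := by positivity
  have z5 : 0 ≤ τ * h * Sr := by positivity
  have z6 : 0 ≤ τ * (c / 2 * (h * ∑ j ∈ Finset.range M, Dh h e' j ^ 2)) := by positivity
  linarith

/-- One step of a discrete Gronwall inequality with implicit right-hand side. -/
lemma gronwall_step {F F' s τ R n : ℝ} (hs : 0 ≤ s) (hs2 : s ≤ 1 / 2) (hτ : 0 ≤ τ) (hR : 0 ≤ R)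
    (hn : 0 ≤ n) (hstep : F' ≤ F + s * (F + F') + τ * R)
    (hF : F ≤ Real.exp (4 * s * n) * (2 * (n * τ) * R)) :
    F' ≤ Real.exp (4 * s * (n + 1)) * (2 * ((n + 1) * τ) * R) := by
  set G := Real.exp (4 * s * n) * (2 * (n * τ) * R) with hG
  have hG0 : 0 ≤ G := by positivity
  have hτR : 0 ≤ τ * R := by positivity
  have h1 : F' ≤ (1 + 4 * s) * G + 2 * (τ * R) := by
    have h2 : (1 - s) * F' ≤ (1 - s) * ((1 + 4 * s) * G + 2 * (τ * R)) := by
      have a1 : (1 + s) * F ≤ (1 + s) * G := by gcongr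
      have a2 : 0 ≤ s * (1 - 2 * s) * G := by
        have : 0 ≤ 1 - 2 * s := by linarith
        positivity
      have a3 : 0 ≤ (1 - 2 * s) * (τ * R) := mul_nonneg (by linarith) hτR
      linarith
    exact le_of_mul_le_mul_left h2 (by linarith)
  have h2 : (1 + 4 * s) * G ≤ Real.exp (4 * s) * G := by
    gcongr
    linarith [Real.add_one_le_exp (4 * s)]
  have h3 : Real.exp (4 * s * (n + 1)) = Real.exp (4 * s) * Real.exp (4 * s * n) := by
    rw [← Real.exp_add]
    ring_nf
  have h4 : 1 ≤ Real.exp (4 * s * (n + 1)) := Real.one_le_exp (by positivity)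
  have h5 : 2 * (τ * R) ≤ Real.exp (4 * s * (n + 1)) * (2 * (τ * R)) :=
    le_mul_of_one_le_left (by positivity) h4
  calc F' ≤ Real.exp (4 * s) * G + Real.exp (4 * s * (n + 1)) * (2 * (τ * R)) := by linarith
    _ = _ := by rw [hG, h3]; ring

lemma sum_sq_le_of_norm2_le {M : ℕ} {h E : ℝ} (hh : 0 < h) {l : ℕ → ℝ} (hE : norm2 M h l ≤ E) :
    h * ∑ i ∈ Finset.Ico 1 M, l i ^ 2 ≤ E ^ 2 := by
  have hS : 0 ≤ ∑ i ∈ Finset.Ico 1 M, l i ^ 2 := Finset.sum_nonneg fun _ _ => sq_nonneg _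
  have h1 := (Real.sqrt_le_iff.1 hE).2
  refine le_trans ?_ h1
  gcongr
  nlinarith [sq_nonneg (l 0), sq_nonneg (l M)]

lemma norm2_le_of_sum_sq_le {M : ℕ} {h E : ℝ} (hE0 : 0 ≤ E) {l : ℕ → ℝ} (h0 : l 0 = 0)
    (hMl : l M = 0) (hE : h * ∑ i ∈ Finset.Ico 1 M, l i ^ 2 ≤ E ^ 2) : norm2 M h l ≤ E := by
  refine Real.sqrt_le_iff.2 ⟨hE0, ?_⟩
  simpa [h0, hMl] using hE

lemma flux_diff_mul {D D' : ℝ} (f : ℝ) (hD : D ≠ 0) (hD' : D' ≠ 0) :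
    (f / D - f / D') * (D - D') = -(f / (D * D') * (D - D') ^ 2) := by
  field_simp
  ring

/-- Discrete core of the convergence theorem: if `x` solves the fully discrete
energetic-variational scheme for the trajectory equation of the PME, and `W` is an
admissible comparison solution solving the same scheme up to residuals of size
`O(τ³ + h⁴)` and obeying uniform regularity bounds, then `‖Wⁿ − xⁿ‖₂ ≤ γ(τ³ + h⁴)`
for all `0 ≤ n ≤ N`, with `γ, σ₀` depending only on the fixed data. -/
theorem stmt11
    (m T A B c₁ c₂ b_f B_f δ₀ Cs Cst Ctst Ce : ℝ)
    (hm : 1 < m) (hT : 0 < T) (hAB : A < B)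
    (hc₁ : 0 < c₁) (hc₁₂ : c₁ ≤ c₂)
    (hbf : 0 < b_f) (hbfBf : b_f ≤ B_f)
    (hδ₀ : 0 < δ₀) (hCs : 0 < Cs) (hCst : 0 < Cst) (hCtst : 0 < Ctst) (hCe : 0 < Ce) :
    ∃ γ > 0, ∃ σ₀ > 0,
      ∀ (M : ℕ), 2 ≤ M →
      ∀ (h τ : ℝ), h = (B - A) / M → 0 < τ →
        c₁ * τ ≤ h → h ≤ c₂ * τ → τ ≤ σ₀ → h ≤ σ₀ →
      ∀ (N : ℕ), (N : ℝ) * τ ≤ T →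
      ∀ (f₀ : ℝ → ℝ), (∀ s ∈ Set.Icc A B, b_f ≤ f₀ s ∧ f₀ s ≤ B_f) →
      ∀ (x W r : ℕ → ℕ → ℝ),
        -- x⁰, …, x^N ∈ Q
        (∀ n ≤ N, x n 0 = A ∧ x n M = B ∧
          ∀ i, 1 ≤ i → i ≤ M → x n (i - 1) < x n i) →
        -- W⁰, …, W^N ∈ Q
        (∀ n ≤ N, W n 0 = A ∧ W n M = B ∧
          ∀ i, 1 ≤ i → i ≤ M → W n (i - 1) < W n i) →
        -- W⁰ = x⁰
        (∀ i ≤ M, W 0 i = x 0 i) →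
        -- (i) the fully discrete scheme for x
        (∀ n < N, ∀ i, 1 ≤ i → i ≤ M - 1 →
          f₀ (A + i * h) / (m * (f₀ (A + i * h) / Dtil M h (x n) i) ^ (m - 1)) *
              ((x (n + 1) i - x n i) / τ)
            = -dh h (fun j => f₀ (A + (j + 1 / 2) * h) / Dh h (x (n + 1)) j) i) →
        -- (ii) the perturbed scheme for W with residual r
        (∀ n < N, ∀ i, 1 ≤ i → i ≤ M - 1 →
          f₀ (A + i * h) / (m * (f₀ (A + i * h) / Dtil M h (W n) i) ^ (m - 1)) *
              ((W (n + 1) i - W n i) / τ)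
            = -dh h (fun j => f₀ (A + (j + 1 / 2) * h) / Dh h (W (n + 1)) j) i + r n i) →
        (∀ n < N, norm2 M h (r n) ≤ Ce * (τ ^ 3 + h ^ 4)) →
        -- (iii) uniform bounds on W
        (∀ n ≤ N, ∀ i ≤ M, δ₀ ≤ Dtil M h (W n) i ∧ |Dtil M h (W n) i| ≤ Cs) →
        (∀ n ≤ N, ∀ j < M, δ₀ ≤ Dh h (W n) j ∧ |Dh h (W n) j| ≤ Cs) →
        (∀ n < N, ∀ i ≤ M, |(W (n + 1) i - W n i) / τ| ≤ Cst) →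
        (∀ n, 1 ≤ n → n ≤ N →
          ∀ i ≤ M, |(Dtil M h (W n) i - Dtil M h (W (n - 1)) i) / τ| ≤ Ctst) →
        ∀ n ≤ N, norm2 M h (fun i => W n i - x n i) ≤ γ * (τ ^ 3 + h ^ 4) := by
  obtain ⟨α, hα, β, hβ, L, hL, hmob⟩ :=
    exists_mobility_bounds m b_f B_f (δ₀ / 2) (Cs + δ₀) hm hbf hbfBf (by positivity) (by linarith)
  have hc₂ : 0 < c₂ := hc₁.trans_le hc₁₂
  obtain ⟨c, hcdef⟩ : ∃ c, c = b_f / (Cs + δ₀) ^ 2 := ⟨_, rfl⟩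
  have hc : 0 < c := by rw [hcdef]; positivity
  obtain ⟨C₁, hC₁def⟩ : ∃ C, C = L * (1 + Ctst) / 2 + 1 / 2 + (L * Cst) ^ 2 / (2 * c) := ⟨_, rfl⟩
  have hC₁ : 0 < C₁ := by rw [hC₁def]; positivity
  obtain ⟨C₂, hC₂def⟩ : ∃ C, C = C₁ * (2 / α) := ⟨_, rfl⟩
  have hC₂ : 0 < C₂ := by rw [hC₂def]; positivity
  obtain ⟨K, hKdef⟩ : ∃ K, K = 4 / α ^ 2 * (β ^ 2 + 4 * (L * Cst) ^ 2 / c₁ ^ 2 + 1) := ⟨_, rfl⟩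
  have hK : 0 < K := by rw [hKdef]; positivity
  obtain ⟨Γ, hΓdef⟩ : ∃ Γ, Γ = 2 / α * (Real.exp (4 * C₂ * T) * (2 * T * Ce ^ 2)) := ⟨_, rfl⟩
  have hΓ : 0 < Γ := by rw [hΓdef]; positivity
  obtain ⟨Q, hQdef⟩ : ∃ Q, Q = (K + 1) * (Γ + Ce ^ 2) * (1 / c₁ ^ 3 + 1) ^ 2 := ⟨_, rfl⟩
  have hQ : 0 < Q := by rw [hQdef]; positivity
  refine ⟨Real.sqrt Γ, Real.sqrt_pos.2 hΓ,
    min (min 1 (1 / (2 * C₂))) (min (δ₀ ^ 2 / (16 * Q)) (1 / (4 * Q * c₂ ^ 2))), by positivity, ?_⟩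
  intro M hM h τ hh hτ hc₁τ hc₂τ hτσ hhσ N hNT f₀ hf₀ x W r hx hW hinit hsx hsW hr hDt hDh hVel hAcc
  obtain ⟨⟨hτ1, hτC⟩, -⟩ := And.imp le_min_iff.1 le_min_iff.1 (le_min_iff.1 hτσ)
  obtain ⟨⟨hh1, -⟩, hhδ, hhc⟩ := And.imp le_min_iff.1 le_min_iff.1 (le_min_iff.1 hhσ)
  have hM0 : (0 : ℝ) < M := by
    have : 0 < M := by omega
    exact_mod_cast this
  have hh0 : 0 < h := by rw [hh]; exact div_pos (by linarith) hM0
  have hMh : (M : ℝ) * h = B - A := by rw [hh]; field_simp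
  have hM1 : 1 ≤ M := by omega
  rw [le_div_iff₀ (by positivity)] at hτC hhδ hhc
  set ε := τ ^ 3 + h ^ 4 with hεdef
  have hε : 0 < ε := by positivity
  have hεh : ε ≤ (1 / c₁ ^ 3 + 1) * h ^ 3 := by
    have h1 : τ ^ 3 ≤ 1 / c₁ ^ 3 * h ^ 3 := by
      have := pow_le_pow_left₀ (by positivity) hc₁τ 3
      rw [one_div_mul_eq_div, le_div_iff₀ (by positivity)]
      linarith [mul_pow c₁ τ 3]
    have h2 : h ^ 3 * h ≤ h ^ 3 * 1 := by gcongr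
    linarith [pow_succ h 3]
  have hQε : ∀ E, E ≤ (K + 1) * (Γ * ε ^ 2 + Ce ^ 2 * ε ^ 2) → E ≤ Q * h ^ 6 := by
    intro E hE
    calc E ≤ (K + 1) * (Γ + Ce ^ 2) * ε ^ 2 := by linarith
      _ ≤ (K + 1) * (Γ + Ce ^ 2) * ((1 / c₁ ^ 3 + 1) * h ^ 3) ^ 2 := by gcongr
      _ = Q * h ^ 6 := by rw [hQdef]; ring
  have hgridδ : 4 * (Q * h ^ 6) / h ^ 3 ≤ (δ₀ / 2) ^ 2 := by
    have h1 : h * h ^ 2 ≤ h * 1 := by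
      gcongr
      exact pow_le_one₀ hh0.le hh1
    have h2 : 4 * (Q * h ^ 6) / h ^ 3 = 4 * Q * (h * h ^ 2) := by field_simp
    rw [h2]
    have := mul_le_mul_of_nonneg_left h1 (by positivity : 0 ≤ 4 * Q)
    linarith
  have hgridτ : 4 * (Q * h ^ 6) / h ^ 3 ≤ τ ^ 2 := by
    have h1 : h * h ^ 2 ≤ h * (c₂ * τ) ^ 2 := by gcongr
    have h2 : 4 * (Q * h ^ 6) / h ^ 3 = 4 * Q * (h * h ^ 2) := by field_simp
    rw [h2]
    have h3 := mul_le_mul_of_nonneg_left h1 (by positivity : 0 ≤ 4 * Q)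
    have h4 := mul_le_mul_of_nonneg_right hhc (by positivity : 0 ≤ τ ^ 2)
    linarith
  have hnode : ∀ i ∈ Finset.Ico 1 M, f₀ (A + i * h) ∈ Set.Icc b_f B_f := by
    intro i hi
    refine hf₀ _ ⟨by have : 0 ≤ (i : ℝ) * h := by positivity
                     linarith, ?_⟩
    have h1 : (i : ℝ) ≤ M := by exact_mod_cast (Finset.mem_Ico.1 hi).2.le
    have := mul_le_mul_of_nonneg_right h1 hh0.le
    linarith
  have hhalf : ∀ j < M, f₀ (A + (j + 1 / 2) * h) ∈ Set.Icc b_f B_f := by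
    intro j hj
    refine hf₀ _ ⟨by have : 0 ≤ ((j : ℝ) + 1 / 2) * h := by positivity
                     linarith, ?_⟩
    have h1 : (j : ℝ) + 1 ≤ M := by exact_mod_cast hj
    have := mul_le_mul_of_nonneg_right (show (j : ℝ) + 1 / 2 ≤ M by linarith) hh0.le
    linarith
  set e : ℕ → ℕ → ℝ := fun n i => W n i - x n i with hedef
  set a : ℕ → ℕ → ℝ := fun n i => mobility m (f₀ (A + i * h)) (Dtil M h (W n) i) with hadef
  set p : ℕ → ℕ → ℝ := fun n i => mobility m (f₀ (A + i * h)) (Dtil M h (x n) i) with hpdef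
  have he0 : ∀ n ≤ N, e n 0 = 0 := fun n hn => by simp [hedef, (hx n hn).1, (hW n hn).1]
  have heM : ∀ n ≤ N, e n M = 0 := fun n hn => by simp [hedef, (hx n hn).2.1, (hW n hn).2.1]
  have hDtW : ∀ n ≤ N, ∀ i ∈ Finset.Ico 1 M, Dtil M h (W n) i ∈ Set.Icc (δ₀ / 2) (Cs + δ₀) := by
    intro n hn i hi
    obtain ⟨h1, h2⟩ := hDt n hn i (Finset.mem_Ico.1 hi).2.le
    exact ⟨by linarith, by linarith [le_abs_self (Dtil M h (W n) i)]⟩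
  have haα : ∀ n ≤ N, ∀ i ∈ Finset.Ico 1 M, α ≤ a n i := fun n hn i hi =>
    (hmob _ (hnode i hi) _ (hDtW n hn i hi)).1
  have hclose : ∀ n ≤ N, h * ∑ i ∈ Finset.Ico 1 M, e n i ^ 2 ≤ Q * h ^ 6 →
      ∀ i ∈ Finset.Ico 1 M, Dtil M h (x n) i ∈ Set.Icc (δ₀ / 2) (Cs + δ₀) ∧
        |Dtil M h (e n) i| ≤ τ := by
    intro n hn hS i hi
    have h1 := sq_Dtil_le_of_norm_le hh0 (he0 n hn) (heM n hn) hS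
      (Finset.mem_Ico.1 hi).1 (Finset.mem_Ico.1 hi).2
    have h2 := abs_le.1 (abs_le_of_sq_le_sq (h1.trans hgridδ) (by positivity))
    refine ⟨?_, abs_le_of_sq_le_sq (h1.trans hgridτ) hτ.le⟩
    rw [hedef, Dtil_sub] at h2
    obtain ⟨h3, h4⟩ := hDt n hn i (Finset.mem_Ico.1 hi).2.le
    have h5 := le_abs_self (Dtil M h (W n) i)
    exact ⟨by linarith, by linarith⟩
  have hfromF : ∀ n ≤ N,
      errorEnergy M h τ c (a n) (e n) ≤
        Real.exp (4 * (C₂ * τ) * n) * (2 * (n * τ) * (Ce ^ 2 * ε ^ 2)) →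
      h * ∑ i ∈ Finset.Ico 1 M, e n i ^ 2 ≤ Γ * ε ^ 2 := by
    intro n hn hF
    have hnT : (n : ℝ) * τ ≤ T := by
      have h1 : (n : ℝ) ≤ N := by exact_mod_cast hn
      exact (mul_le_mul_of_nonneg_right h1 hτ.le).trans hNT
    calc h * ∑ i ∈ Finset.Ico 1 M, e n i ^ 2 ≤ 2 / α * errorEnergy M h τ c (a n) (e n) :=
          norm_le_errorEnergy hh0 hτ hc hα (e n) (haα n hn)
      _ ≤ 2 / α * (Real.exp (4 * C₂ * (n * τ)) * (2 * (n * τ) * (Ce ^ 2 * ε ^ 2))) := by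
          refine mul_le_mul_of_nonneg_left (hF.trans_eq ?_) (by positivity)
          rw [show 4 * (C₂ * τ) * (n : ℝ) = 4 * C₂ * (n * τ) by ring]
      _ ≤ 2 / α * (Real.exp (4 * C₂ * T) * (2 * T * (Ce ^ 2 * ε ^ 2))) := by gcongr
      _ = Γ * ε ^ 2 := by rw [hΓdef]; ring
  have hind : ∀ n : ℕ, n ≤ N → errorEnergy M h τ c (a n) (e n) ≤
      Real.exp (4 * (C₂ * τ) * n) * (2 * (n * τ) * (Ce ^ 2 * ε ^ 2)) := by
    intro n
    induction n with
    | zero =>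
      intro _
      have hz : ∀ i ≤ M, e 0 i = 0 := fun i hi => by simp [hedef, hinit i hi]
      have h1 : ∑ i ∈ Finset.Ico 1 M, a 0 i * e 0 i ^ 2 / 2 = 0 :=
        Finset.sum_eq_zero fun i hi => by rw [hz i (Finset.mem_Ico.1 hi).2.le]; ring
      have h2 : ∑ j ∈ Finset.range M, Dh h (e 0) j ^ 2 = 0 :=
        Finset.sum_eq_zero fun j hj => by
          rw [Dh, hz _ (Finset.mem_range.1 hj), hz _ (Finset.mem_range.1 hj).le]
          simp
      simp [errorEnergy, h1, h2]
    | succ n ih =>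
      intro hn1
      have hn : n < N := hn1
      have ihn := ih hn.le
      have hS := hfromF n hn.le ihn
      have hR : h * ∑ i ∈ Finset.Ico 1 M, r n i ^ 2 ≤ Ce ^ 2 * ε ^ 2 :=
        (sum_sq_le_of_norm2_le hh0 (hr n hn)).trans_eq (mul_pow _ _ _)
      have hSQ : h * ∑ i ∈ Finset.Ico 1 M, e n i ^ 2 ≤ Q * h ^ 6 := by
        refine hQε _ (hS.trans ?_)
        have h1 : 0 ≤ K * (Γ * ε ^ 2) := by positivity
        have h2 : 0 ≤ (K + 1) * (Ce ^ 2 * ε ^ 2) := by positivity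
        linarith
      have hxn := hclose n hn.le hSQ
      have hp : ∀ i ∈ Finset.Ico 1 M, α ≤ p n i ∧ p n i ≤ β := fun i hi =>
        ⟨(hmob _ (hnode i hi) _ (hxn i hi).1).1, (hmob _ (hnode i hi) _ (hxn i hi).1).2.1⟩
      have hap : ∀ i ∈ Finset.Ico 1 M, |a n i - p n i| ≤ L * |Dtil M h (e n) i| := by
        intro i hi
        rw [hedef, Dtil_sub]
        exact (hmob _ (hnode i hi) _ (hDtW n hn.le i hi)).2.2 _ (hxn i hi).1
      set g : ℕ → ℝ := fun i => (a n i - p n i) * ((W (n + 1) i - W n i) / τ) with hgdef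
      have hg : ∀ i ∈ Finset.Ico 1 M, g i ^ 2 ≤ (L * Cst) ^ 2 * Dtil M h (e n) i ^ 2 := by
        intro i hi
        rw [← mul_pow, sq_le_sq, abs_mul, abs_mul, abs_of_pos (mul_pos hL hCst)]
        calc |a n i - p n i| * |(W (n + 1) i - W n i) / τ|
            ≤ L * |Dtil M h (e n) i| * Cst :=
              mul_le_mul (hap i hi) (hVel n hn i (Finset.mem_Ico.1 hi).2.le) (abs_nonneg _)
                (by positivity)
          _ = L * Cst * |Dtil M h (e n) i| := by ring
      set ψ : ℕ → ℝ := fun j => f₀ (A + (j + 1 / 2) * h) / Dh h (W (n + 1)) j -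
        f₀ (A + (j + 1 / 2) * h) / Dh h (x (n + 1)) j with hψdef
      have heq : ∀ i ∈ Finset.Ico 1 M,
          p n i * ((e (n + 1) i - e n i) / τ) = -dh h ψ i + r n i - g i := by
        intro i hi
        obtain ⟨hi1, hi2⟩ := Finset.mem_Ico.1 hi
        have h1 : p n i * ((x (n + 1) i - x n i) / τ) = _ := hsx n hn i hi1 (by omega)
        have h2 : a n i * ((W (n + 1) i - W n i) / τ) = _ := hsW n hn i hi1 (by omega)
        have h3 : dh h ψ i =
            dh h (fun j => f₀ (A + (j + 1 / 2) * h) / Dh h (W (n + 1)) j) i -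
            dh h (fun j => f₀ (A + (j + 1 / 2) * h) / Dh h (x (n + 1)) j) i := by
          simp only [dh, hψdef]
          ring
        have h4 : p n i * ((e (n + 1) i - e n i) / τ) =
            p n i * ((W (n + 1) i - W n i) / τ) - p n i * ((x (n + 1) i - x n i) / τ) := by
          simp only [hedef]
          ring
        rw [h4, h3, h1, hgdef]
        linarith
      have hDhx : ∀ j < M, 0 < Dh h (x (n + 1)) j := fun j hj =>
        div_pos (sub_pos.2 (by simpa using (hx (n + 1) hn1).2.2 (j + 1) (by omega) hj)) hh0
      have hDhW : ∀ j < M, 0 < Dh h (W (n + 1)) j := fun j hj =>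
        hδ₀.trans_le (hDh (n + 1) hn1 j hj).1
      have hψmul : ∀ j < M, ψ j * Dh h (e (n + 1)) j =
          -(f₀ (A + (j + 1 / 2) * h) / (Dh h (W (n + 1)) j * Dh h (x (n + 1)) j) *
            Dh h (e (n + 1)) j ^ 2) := by
        intro j hj
        rw [hedef, Dh_sub]
        exact flux_diff_mul _ (hDhW j hj).ne' (hDhx j hj).ne'
      have hψ0 : ∀ j < M, ψ j * Dh h (e (n + 1)) j ≤ 0 := by
        intro j hj
        rw [hψmul j hj, neg_nonpos]
        have h1 := hDhx j hj
        have h2 := hDhW j hj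
        have h3 := hbf.trans_le (hhalf j hj).1
        positivity
      have hS'Q : h * ∑ i ∈ Finset.Ico 1 M, e (n + 1) i ^ 2 ≤ Q * h ^ 6 := by
        have h1 := rough_step hM1 hh0 hτ hτ1 hc₁ hc₁τ hα (he0 n hn.le) (heM n hn.le)
          (he0 (n + 1) hn1) (heM (n + 1) hn1) heq hψ0 hp hg
        rw [← hKdef] at h1
        have h2 := mul_le_mul_of_nonneg_left (add_le_add hS hR) hK.le
        have h3 : 0 ≤ Γ * ε ^ 2 + Ce ^ 2 * ε ^ 2 := by positivity
        exact hQε _ (by linarith)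
      have hψc : ∀ j < M, ψ j * Dh h (e (n + 1)) j ≤ -(c * Dh h (e (n + 1)) j ^ 2) := by
        intro j hj
        rw [hψmul j hj, hcdef]
        have h1 := hDhx j hj
        have h2 := hDhW j hj
        have h3 := sq_Dh_le_of_norm_le hh0 (he0 (n + 1) hn1) (heM (n + 1) hn1) hS'Q hj
        have h4 := abs_le.1 (abs_le_of_sq_le_sq (h3.trans hgridδ) (by positivity))
        have h5 : Dh h (W (n + 1)) j ≤ Cs :=
          (le_abs_self _).trans (hDh (n + 1) hn1 j hj).2
        have h6 : Dh h (x (n + 1)) j ≤ Cs + δ₀ := by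
          have h7 : Dh h (e (n + 1)) j = Dh h (W (n + 1)) j - Dh h (x (n + 1)) j := by
            rw [hedef, Dh_sub]
          linarith
        have h8 := (hhalf j hj).1
        rw [neg_le_neg_iff]
        refine mul_le_mul_of_nonneg_right ?_ (sq_nonneg _)
        refine div_le_div₀ (hbf.le.trans h8) h8 (by positivity) ?_
        rw [sq]
        exact mul_le_mul (by linarith) h6 h1.le (by positivity)
      have hpa : ∀ i ∈ Finset.Ico 1 M, |a n i - p n i| ≤ L * τ := fun i hi =>
        (hap i hi).trans (mul_le_mul_of_nonneg_left (hxn i hi).2 hL.le)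
      have haa : ∀ i ∈ Finset.Ico 1 M, |a (n + 1) i - a n i| ≤ L * (Ctst * τ) := by
        intro i hi
        refine ((hmob _ (hnode i hi) _ (hDtW (n + 1) hn1 i hi)).2.2 _
          (hDtW n hn.le i hi)).trans (mul_le_mul_of_nonneg_left ?_ hL.le)
        have h1 := hAcc (n + 1) (by omega) hn1 i (Finset.mem_Ico.1 hi).2.le
        rwa [Nat.add_sub_cancel, abs_div, abs_of_pos hτ, div_le_iff₀ hτ] at h1
      have hstep := refined_step (a := a n) (a' := a (n + 1)) (K := L * (1 + Ctst)) (L := L * Cst)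
        hM1 hh0 hτ hc (he0 (n + 1) hn1) (heM (n + 1) hn1) heq hψc
        (fun i hi => hα.le.trans (hp i hi).1)
        (fun i hi => by
          have h1 := abs_le.1 (hpa i hi)
          have h2 : 0 ≤ L * (Ctst * τ) := by positivity
          linarith)
        (fun i hi => by
          have h1 := abs_le.1 (hpa i hi)
          have h2 := abs_le.1 (haa i hi)
          linarith) hg
      rw [← hC₁def] at hstep
      have hF := norm_le_errorEnergy hh0 hτ hc hα (e n) (haα n hn.le)
      have hF' := norm_le_errorEnergy hh0 hτ hc hα (e (n + 1)) (haα (n + 1) hn1)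
      have h1 := mul_le_mul_of_nonneg_left (add_le_add hF hF') (mul_pos hτ hC₁).le
      have h2 := mul_le_mul_of_nonneg_left hR hτ.le
      push_cast
      refine gronwall_step (by positivity) (by linarith) hτ.le (by positivity) (by positivity)
        ?_ ihn
      rw [hC₂def]
      linarith
  intro n hn
  refine norm2_le_of_sum_sq_le (by positivity) (he0 n hn) (heM n hn) ?_
  rw [mul_pow, Real.sq_sqrt hΓ.le]
  exact hfromF n hn (hind n hn)
end

section
/- In the setting of the discrete convergence framework (same grid, operators, norms, admissible set Q, scheme (i), perturbed scheme (ii) with ‖rⁿ‖₂ ≤ C_e(τ³ + h⁴), and uniform bounds (iii) on W as listed in the context), fix a time level n ≤ N−1 and assume additionally the a-priori bound ‖ Wⁿ − xⁿ ‖₂ ≤ τ^{11/4} + h^{7/2} and that ‖D̃_h(Wⁿ − xⁿ)‖_∞ is small enough that (D̃_h xⁿ)_i ≥ δ₀/2 and ‖D̃_h xⁿ‖_∞ ≤ C* + 1. Then there exist constants C̃ > 0 and σ₀ > 0, depending only on (m, b_f, B_f, δ₀, C*, C*_t, C_e, T, c₁, c₂) and not on n, M, h, τ, such that if τ, h ≤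 σ₀ and c₁τ ≤ h ≤ c₂τ, then ‖ W^{n+1} − x^{n+1} ‖₂ ≤ C̃ · τ^{1/2} · ( τ^{7/4} + h^{5/2} ), and consequently ‖ D_h x^{n+1} ‖_∞ ≤ C* + 1. -/
/-- The coefficient `f / (m (f / y)^{m-1})` of the time derivative in the scheme. -/
noncomputable def weight (m f y : ℝ) : ℝ := f / (m * (f / y) ^ (m - 1))

lemma weight_eq {m f y : ℝ} (hf : 0 < f) (hy : 0 < y) :
    weight m f y = f / (m * f ^ (m - 1)) * y ^ (m - 1) := by
  have := Real.rpow_pos_of_pos hf (m - 1)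
  have := Real.rpow_pos_of_pos hy (m - 1)
  rw [weight, Real.div_rpow hf.le hy.le]
  by_cases hm : m = 0
  · simp [hm]
  field_simp

lemma weight_lower {m b f B d y : ℝ} (hm : 1 < m) (hb : 0 < b) (hbf : b ≤ f) (hfB : f ≤ B)
    (hd : 0 < d) (hdy : d ≤ y) :
    b / (m * B ^ (m - 1)) * d ^ (m - 1) ≤ weight m f y := by
  have hf := hb.trans_le hbf
  have := Real.rpow_pos_of_pos hf (m - 1)
  have := Real.rpow_pos_of_pos hd (m - 1)
  rw [weight_eq hf (hd.trans_le hdy)]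
  gcongr

lemma coeff_upper {m b f B : ℝ} (hm : 1 < m) (hb : 0 < b) (hbf : b ≤ f) (hfB : f ≤ B) :
    f / (m * f ^ (m - 1)) ≤ B / (m * b ^ (m - 1)) := by
  have := Real.rpow_pos_of_pos hb (m - 1)
  have hf := hb.trans_le hbf
  gcongr
  linarith

lemma weight_upper {m b f B d D y : ℝ} (hm : 1 < m) (hb : 0 < b) (hbf : b ≤ f) (hfB : f ≤ B)
    (hd : 0 < d) (hdy : d ≤ y) (hyD : y ≤ D) :
    weight m f y ≤ B / (m * b ^ (m - 1)) * D ^ (m - 1) := by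
  have hy := hd.trans_le hdy
  have hB : 0 < B := by linarith
  rw [weight_eq (hb.trans_le hbf) hy]
  have := Real.rpow_pos_of_pos hb (m - 1)
  exact mul_le_mul (coeff_upper hm hb hbf hfB)
    (Real.rpow_le_rpow hy.le hyD (by linarith)) (by positivity) (by positivity)

lemma exists_weight_lipschitz {m b B d D : ℝ} (hm : 1 < m) (hb : 0 < b) (hbB : b ≤ B)
    (hd : 0 < d) :
    ∃ L, ∀ f y z, b ≤ f → f ≤ B → d ≤ y → y ≤ D → d ≤ z → z ≤ D →
      |weight m f y - weight m f z| ≤ L * |y - z| := by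
  have hC : ContDiffOn ℝ 1 (fun y : ℝ => y ^ (m - 1)) (Set.Icc d D) := fun y hy =>
    (Real.contDiffAt_rpow_const_of_ne (hd.trans_le hy.1).ne').contDiffWithinAt
  obtain ⟨K, hK⟩ := hC.exists_lipschitzOnWith one_ne_zero (convex_Icc d D) isCompact_Icc
  refine ⟨B / (m * b ^ (m - 1)) * K, fun f y z hbf hfB hy hyD hz hzD => ?_⟩
  have hf := hb.trans_le hbf
  have := Real.rpow_pos_of_pos hf (m - 1)
  have := Real.rpow_pos_of_pos hb (m - 1)
  have hBpos : 0 < B := by linarith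
  have h1 := hK.dist_le_mul y ⟨hy, hyD⟩ z ⟨hz, hzD⟩
  rw [Real.dist_eq, Real.dist_eq] at h1
  rw [weight_eq hf (hd.trans_le hy), weight_eq hf (hd.trans_le hz), ← mul_sub, abs_mul,
    abs_of_nonneg (by positivity), mul_assoc]
  exact mul_le_mul (coeff_upper hm hb hbf hfB) h1 (abs_nonneg _) (by positivity)

lemma sum_Ico_sub_mul (φ e : ℕ → ℝ) (he0 : e 0 = 0) (M : ℕ) (hM : 1 ≤ M) :
    ∑ i ∈ Finset.Ico 1 M, (φ i - φ (i - 1)) * e i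
      = φ (M - 1) * e M - ∑ j ∈ Finset.range M, φ j * (e (j + 1) - e j) := by
  induction M, hM using Nat.le_induction with
  | base => simp [he0]
  | succ k hk ih =>
    rw [Finset.sum_Ico_succ_top hk, ih, Finset.sum_range_succ]
    simp only [Nat.add_sub_cancel]
    ring

lemma sum_sq_central_diff_le (e : ℕ → ℝ) (h : ℝ) (M : ℕ) (he0 : e 0 = 0) (heM : e M = 0) :
    ∑ i ∈ Finset.Ico 1 M, Dtil M h e i ^ 2 ≤ (∑ i ∈ Finset.Ico 1 M, e i ^ 2) / h ^ 2 := by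
  rcases Nat.lt_or_ge M 1 with h0 | hM
  · simp [Finset.Ico_eq_empty_of_le h0.le]
  have hsucc : ∑ i ∈ Finset.Ico 1 M, e (i + 1) ^ 2 ≤ ∑ i ∈ Finset.Ico 1 M, e i ^ 2 := by
    have h1 := Finset.sum_Ico_succ_top hM fun i => e i ^ 2
    have h2 := Finset.sum_Ico_add' (fun i => e i ^ 2) 1 M 1
    have h3 := Finset.sum_eq_sum_Ico_succ_bot (Nat.lt_succ_of_le hM) fun i => e i ^ 2
    simp only [heM] at h1
    simp only [Nat.succ_eq_add_one] at *
    nlinarith [sq_nonneg (e 1)]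
  have hpred : ∑ i ∈ Finset.Ico 1 M, e (i - 1) ^ 2 ≤ ∑ i ∈ Finset.Ico 1 M, e i ^ 2 := by
    obtain ⟨k, rfl⟩ := Nat.exists_eq_add_of_le' hM
    have h2 := Finset.sum_Ico_add' (fun i => e (i - 1) ^ 2) 0 k 1
    simp only [Nat.add_sub_cancel, zero_add] at h2
    rw [← h2]
    rcases Nat.eq_zero_or_pos k with rfl | hk
    · simp
    rw [Finset.sum_eq_sum_Ico_succ_bot hk, Finset.sum_Ico_succ_top hk, he0]
    simp only [zero_add]
    nlinarith [sq_nonneg (e k)]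
  have hpt : ∀ i ∈ Finset.Ico 1 M,
      Dtil M h e i ^ 2 ≤ (e (i + 1) ^ 2 + e (i - 1) ^ 2) / 2 / h ^ 2 := by
    intro i hi
    rw [Finset.mem_Ico] at hi
    rw [Dtil, if_neg (by omega), if_neg (by omega), div_pow, mul_pow, ← div_div]
    refine div_le_div_of_nonneg_right ?_ (sq_nonneg h)
    nlinarith [sq_nonneg (e (i + 1) + e (i - 1))]
  refine (Finset.sum_le_sum hpt).trans ?_
  rw [← Finset.sum_div, ← Finset.sum_div, Finset.sum_add_distrib]
  gcongr
  linarith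

/-- Monotonicity of the nonlinear diffusion term. -/
lemma sum_dh_mul_nonneg {M : ℕ} (hM : 1 ≤ M) {h : ℝ} (hh : 0 < h) {F u v : ℕ → ℝ}
    (hF : ∀ j < M, 0 ≤ F j) (hu : ∀ j < M, 0 < Dh h u j) (hv : ∀ j < M, 0 < Dh h v j)
    (h0 : u 0 = v 0) (hMM : u M = v M) :
    0 ≤ ∑ i ∈ Finset.Ico 1 M,
      (dh h (fun j => F j / Dh h u j) i - dh h (fun j => F j / Dh h v j) i) * (u i - v i) := by
  have key := sum_Ico_sub_mul (fun j => F j / Dh h u j - F j / Dh h v j) (fun k => u k - v k)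
    (by simp [h0]) M hM
  have hterm : ∀ j ∈ Finset.range M, (F j / Dh h u j - F j / Dh h v j) *
      (u (j + 1) - v (j + 1) - (u j - v j)) ≤ 0 := by
    intro j hj
    rw [Finset.mem_range] at hj
    have hp := hu j hj
    have hq := hv j hj
    have hd : u (j + 1) - v (j + 1) - (u j - v j) = h * (Dh h u j - Dh h v j) := by
      unfold Dh; field_simp; ring
    have : (F j / Dh h u j - F j / Dh h v j) * (h * (Dh h u j - Dh h v j))
        = -(F j * h * (Dh h u j - Dh h v j) ^ 2 / (Dh h u j * Dh h v j)) := by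
      field_simp; ring
    rw [hd, this, neg_nonpos]
    have := hF j hj
    positivity
  have hs := Finset.sum_nonpos hterm
  have : ∑ i ∈ Finset.Ico 1 M,
      (dh h (fun j => F j / Dh h u j) i - dh h (fun j => F j / Dh h v j) i) * (u i - v i)
      = (∑ i ∈ Finset.Ico 1 M, ((F i / Dh h u i - F i / Dh h v i)
        - (F (i - 1) / Dh h u (i - 1) - F (i - 1) / Dh h v (i - 1))) * (u i - v i)) / h := by
    rw [Finset.sum_div]
    refine Finset.sum_congr rfl fun i _ => ?_
    unfold dh
    ring
  rw [this, key, hMM]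
  apply div_nonneg _ hh.le
  simp only [sub_self, mul_zero, zero_sub]
  linarith

lemma sum_sq_le_of_sum_mul_le {s : Finset ℕ} {a e g : ℕ → ℝ} {α : ℝ} (hα : 0 < α)
    (ha : ∀ i ∈ s, α ≤ a i) (h : ∑ i ∈ s, (a i * e i - g i) * e i ≤ 0) :
    ∑ i ∈ s, e i ^ 2 ≤ (∑ i ∈ s, g i ^ 2) / α ^ 2 := by
  have hpt : ∀ i ∈ s, α / 2 * e i ^ 2 - g i ^ 2 / (2 * α) ≤ (a i * e i - g i) * e i := by
    intro i hi
    have h1 : α * e i ^ 2 ≤ a i * e i ^ 2 := by gcongr; exact ha i hi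
    have h2 : g i * e i ≤ α / 2 * e i ^ 2 + g i ^ 2 / (2 * α) := by
      have : α / 2 * e i ^ 2 + g i ^ 2 / (2 * α) - g i * e i = (α * e i - g i) ^ 2 / (2 * α) := by
        field_simp; ring
      have : 0 ≤ (α * e i - g i) ^ 2 / (2 * α) := by positivity
      linarith
    nlinarith
  have := (Finset.sum_le_sum hpt).trans h
  rw [Finset.sum_sub_distrib, ← Finset.mul_sum, ← Finset.sum_div, sub_nonpos] at this
  rw [le_div_iff₀ (by positivity)] at this ⊢
  linarith

lemma norm2_sq {M : ℕ} {h : ℝ} (hh : 0 ≤ h) (l : ℕ → ℝ) :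
    norm2 M h l ^ 2 = h * (l 0 ^ 2 / 2 + ∑ i ∈ Finset.Ico 1 M, l i ^ 2 + l M ^ 2 / 2) := by
  rw [norm2, Real.sq_sqrt]
  have : 0 ≤ ∑ i ∈ Finset.Ico 1 M, l i ^ 2 := Finset.sum_nonneg fun i _ => sq_nonneg _
  positivity

lemma norm2_nonneg (M : ℕ) (h : ℝ) (l : ℕ → ℝ) : 0 ≤ norm2 M h l := Real.sqrt_nonneg _

lemma norm2_sq_of_boundary {M : ℕ} {h : ℝ} (hh : 0 ≤ h) {l : ℕ → ℝ} (h0 : l 0 = 0)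
    (hM : l M = 0) : norm2 M h l ^ 2 = h * ∑ i ∈ Finset.Ico 1 M, l i ^ 2 := by
  rw [norm2_sq hh, h0, hM]; ring

lemma sum_sq_le_norm2_sq {M : ℕ} {h : ℝ} (hh : 0 ≤ h) (l : ℕ → ℝ) :
    h * ∑ i ∈ Finset.Ico 1 M, l i ^ 2 ≤ norm2 M h l ^ 2 := by
  rw [norm2_sq hh]
  gcongr
  linarith [sq_nonneg (l 0), sq_nonneg (l M)]

/-- Inverse inequality for grid functions vanishing at both endpoints. -/
lemma abs_Dh_le_of_norm2_le {M : ℕ} {h R : ℝ} (hh : 0 < h) {l : ℕ → ℝ} (h0 : l 0 = 0)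
    (hM : l M = 0) (hR : norm2 M h l ≤ R) {j : ℕ} (hj : j < M) :
    |Dh h l j| ≤ 2 * R / (√h * h) := by
  have hR0 : 0 ≤ R := (norm2_nonneg M h l).trans hR
  have hpt : ∀ i ≤ M, |l i| ≤ R / √h := by
    intro i hi
    have hs : 0 < √h := Real.sqrt_pos.2 hh
    have : h * l i ^ 2 ≤ norm2 M h l ^ 2 := by
      rw [norm2_sq_of_boundary hh.le h0 hM]
      by_cases hi' : i ∈ Finset.Ico 1 M
      · gcongr
        exact Finset.single_le_sum (f := fun i => l i ^ 2) (fun i _ => sq_nonneg _) hi'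
      · rw [Finset.mem_Ico] at hi'
        have : l i = 0 := by
          rcases Nat.eq_zero_or_pos i with rfl | hp
          · exact h0
          · rwa [show i = M by omega]
        rw [this, zero_pow two_ne_zero, mul_zero]
        exact mul_nonneg hh.le (Finset.sum_nonneg fun i _ => sq_nonneg _)
    rw [le_div_iff₀ hs]
    refine abs_le_of_sq_le_sq' ?_ hR0 |>.2
    rw [mul_pow, sq_abs, Real.sq_sqrt hh.le, mul_comm]
    exact this.trans (pow_le_pow_left₀ (norm2_nonneg M h l) hR 2)
  have h1 := hpt j hj.le
  have h2 := hpt (j + 1) hj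
  rw [Dh, abs_div, abs_of_pos hh, div_le_iff₀ hh]
  have : 2 * R / (√h * h) * h = 2 * (R / √h) := by field_simp
  rw [this]
  linarith [abs_sub (l (j + 1)) (l j)]

/-- One step of the scheme amplifies the `L²` error by at most a constant factor. -/
lemma norm2_sq_step_le {M : ℕ} (hM : 1 ≤ M) {h τ α β κ γ c : ℝ} (hh : 0 < h) (hτ : 0 < τ)
    (hc : 0 < c) (hcτ : c * τ ≤ h) (hα : 0 < α)
    {F a b x W x' W' r : ℕ → ℝ}
    (hF : ∀ j < M, 0 ≤ F j)
    (ha : ∀ i ∈ Finset.Ico 1 M, α ≤ a i ∧ a i ≤ β)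
    (hab : ∀ i ∈ Finset.Ico 1 M, |b i - a i| ≤ κ * |Dtil M h W i - Dtil M h x i|)
    (hx' : ∀ j < M, 0 < Dh h x' j) (hW' : ∀ j < M, 0 < Dh h W' j)
    (h0 : W 0 = x 0) (hE : W M = x M) (h0' : W' 0 = x' 0) (hE' : W' M = x' M)
    (hWt : ∀ i ∈ Finset.Ico 1 M, |(W' i - W i) / τ| ≤ γ)
    (hx : ∀ i ∈ Finset.Ico 1 M,
      a i * ((x' i - x i) / τ) = -dh h (fun j => F j / Dh h x' j) i)
    (hW : ∀ i ∈ Finset.Ico 1 M,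
      b i * ((W' i - W i) / τ) = -dh h (fun j => F j / Dh h W' j) i + r i) :
    norm2 M h (fun i => W' i - x' i) ^ 2 ≤ 3 * (β ^ 2 + (κ * γ) ^ 2 / c ^ 2 + 1) / α ^ 2 *
      (norm2 M h (fun i => W i - x i) ^ 2 + τ ^ 2 * norm2 M h r ^ 2) := by
  set g : ℕ → ℝ := fun i =>
    a i * (W i - x i) - τ * ((b i - a i) * ((W' i - W i) / τ)) + τ * r i with hg
  have hmono := sum_dh_mul_nonneg hM hh hF hW' hx' h0' hE'
  have henergy : ∑ i ∈ Finset.Ico 1 M, (a i * (W' i - x' i) - g i) * (W' i - x' i) ≤ 0 := by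
    have : ∑ i ∈ Finset.Ico 1 M, (a i * (W' i - x' i) - g i) * (W' i - x' i)
        = -(τ * ∑ i ∈ Finset.Ico 1 M, (dh h (fun j => F j / Dh h W' j) i
          - dh h (fun j => F j / Dh h x' j) i) * (W' i - x' i)) := by
      rw [Finset.mul_sum, ← Finset.sum_neg_distrib]
      refine Finset.sum_congr rfl fun i hi => ?_
      have e1 : dh h (fun j => F j / Dh h W' j) i = r i - b i * ((W' i - W i) / τ) := by
        linarith [hW i hi]
      have e2 : dh h (fun j => F j / Dh h x' j) i = -(a i * ((x' i - x i) / τ)) := by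
        linarith [hx i hi]
      rw [e1, e2, hg]
      field_simp
      ring
    rw [this, neg_nonpos]
    positivity
  have hS := sum_sq_le_of_sum_mul_le hα (fun i hi => (ha i hi).1) henergy
  have hgpt : ∀ i ∈ Finset.Ico 1 M, g i ^ 2 ≤ 3 * (β ^ 2 * (W i - x i) ^ 2
      + τ ^ 2 * (κ * γ) ^ 2 * Dtil M h (fun k => W k - x k) i ^ 2 + τ ^ 2 * r i ^ 2) := by
    intro i hi
    have h1 : (a i * (W i - x i)) ^ 2 ≤ β ^ 2 * (W i - x i) ^ 2 := by
      rw [mul_pow]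
      have := ha i hi
      gcongr
      · linarith
      · exact this.2
    have h2 : ((b i - a i) * ((W' i - W i) / τ)) ^ 2
        ≤ (κ * γ) ^ 2 * Dtil M h (fun k => W k - x k) i ^ 2 := by
      rw [Dtil_sub, ← sq_abs, abs_mul, ← sq_abs (Dtil M h W i - Dtil M h x i), ← mul_pow]
      refine pow_le_pow_left₀ (by positivity) ?_ 2
      have := mul_le_mul (hab i hi) (hWt i hi) (abs_nonneg _) ((abs_nonneg _).trans (hab i hi))
      linarith
    have h3 : g i ^ 2 ≤ 3 * ((a i * (W i - x i)) ^ 2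
        + (τ * ((b i - a i) * ((W' i - W i) / τ))) ^ 2 + (τ * r i) ^ 2) := by
      simp only [hg]
      generalize a i * (W i - x i) = p
      generalize τ * ((b i - a i) * ((W' i - W i) / τ)) = q
      generalize τ * r i = s
      nlinarith [sq_nonneg (p + q), sq_nonneg (p - s), sq_nonneg (q + s)]
    have h4 := mul_le_mul_of_nonneg_left h2 (sq_nonneg τ)
    rw [mul_pow τ, mul_pow τ] at h3
    linarith
  have hD := sum_sq_central_diff_le (fun k => W k - x k) h M (by simp [h0]) (by simp [hE])
  have hr := sum_sq_le_norm2_sq (M := M) hh.le r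
  have he := norm2_sq_of_boundary (M := M) (l := fun k => W k - x k) hh.le
    (by simp [h0]) (by simp [hE])
  have he' := norm2_sq_of_boundary (M := M) (l := fun k => W' k - x' k) hh.le
    (by simp [h0']) (by simp [hE'])
  have hG := Finset.sum_le_sum hgpt
  rw [← Finset.mul_sum, Finset.sum_add_distrib, Finset.sum_add_distrib, ← Finset.mul_sum,
    ← Finset.mul_sum, ← Finset.mul_sum] at hG
  rw [he', he]
  set S := ∑ i ∈ Finset.Ico 1 M, (W i - x i) ^ 2
  have hS0 : 0 ≤ S := Finset.sum_nonneg fun i _ => sq_nonneg _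
  have hratio : τ ^ 2 * (S / h ^ 2) ≤ S / c ^ 2 := by
    rw [← mul_div_assoc, div_le_div_iff₀ (by positivity) (by positivity)]
    have : (c * τ) ^ 2 ≤ h ^ 2 := by gcongr
    nlinarith
  have hD' : τ ^ 2 * (κ * γ) ^ 2 * ∑ i ∈ Finset.Ico 1 M, Dtil M h (fun k => W k - x k) i ^ 2
      ≤ (κ * γ) ^ 2 * (S / c ^ 2) := by
    calc _ ≤ τ ^ 2 * (κ * γ) ^ 2 * (S / h ^ 2) := by gcongr
      _ = (κ * γ) ^ 2 * (τ ^ 2 * (S / h ^ 2)) := by ring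
      _ ≤ _ := by gcongr
  set R := ∑ i ∈ Finset.Ico 1 M, r i ^ 2
  have hR0 : 0 ≤ R := Finset.sum_nonneg fun i _ => sq_nonneg _
  set k := β ^ 2 + (κ * γ) ^ 2 / c ^ 2 with hk
  have hk0 : 0 ≤ k := by positivity
  have hG' : ∑ i ∈ Finset.Ico 1 M, g i ^ 2 ≤ 3 * (k + 1) * (S + τ ^ 2 * R) := by
    have e : (κ * γ) ^ 2 * (S / c ^ 2) = (κ * γ) ^ 2 / c ^ 2 * S := by ring
    have e2 : k * S = β ^ 2 * S + (κ * γ) ^ 2 / c ^ 2 * S := by rw [hk]; ring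
    have p1 : 0 ≤ k * (τ ^ 2 * R) := by positivity
    nlinarith
  calc h * ∑ i ∈ Finset.Ico 1 M, (W' i - x' i) ^ 2
      ≤ h * ((3 * (k + 1) * (S + τ ^ 2 * R)) / α ^ 2) := by
        gcongr
        exact hS.trans (by gcongr)
    _ = 3 * (k + 1) / α ^ 2 * (h * S + τ ^ 2 * (h * R)) := by ring
    _ ≤ _ := by gcongr

lemma rough_rate_bound {c₂ Ce τ h : ℝ} (hCe : 0 ≤ Ce) (hτ : 0 < τ) (hh : 0 < h) (hτ1 : τ ≤ 1)
    (hh1 : h ≤ 1) (hhτ : h ≤ c₂ * τ) :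
    τ ^ ((11 : ℝ) / 4) + h ^ ((7 : ℝ) / 2) + τ * (Ce * (τ ^ 3 + h ^ 4))
      ≤ (1 + √c₂ + Ce) * (τ ^ ((1 : ℝ) / 2) * (τ ^ ((7 : ℝ) / 4) + h ^ ((5 : ℝ) / 2))) := by
  have hc₂ : 0 < c₂ := pos_of_mul_pos_left (hh.trans_le hhτ) hτ.le
  have e1 : τ ^ ((11 : ℝ) / 4) ≤ τ ^ ((1 : ℝ) / 2) * τ ^ ((7 : ℝ) / 4) := by
    rw [← Real.rpow_add hτ]
    exact Real.rpow_le_rpow_of_exponent_ge hτ hτ1 (by norm_num)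
  have e2 : h ^ ((7 : ℝ) / 2) ≤ √c₂ * (τ ^ ((1 : ℝ) / 2) * h ^ ((5 : ℝ) / 2)) := by
    have a1 : h ^ ((7 : ℝ) / 2) = h ^ (1 : ℝ) * h ^ ((5 : ℝ) / 2) := by
      rw [← Real.rpow_add hh]; norm_num
    have a2 : h ^ (1 : ℝ) ≤ h ^ ((1 : ℝ) / 2) :=
      Real.rpow_le_rpow_of_exponent_ge hh hh1 (by norm_num)
    have a3 : h ^ ((1 : ℝ) / 2) ≤ √c₂ * τ ^ ((1 : ℝ) / 2) := by
      rw [Real.sqrt_eq_rpow, ← Real.mul_rpow hc₂.le hτ.le]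
      exact Real.rpow_le_rpow hh.le hhτ (by norm_num)
    rw [a1, ← mul_assoc]
    gcongr
    exact a2.trans a3
  have e3 : τ * τ ^ 3 ≤ τ ^ ((1 : ℝ) / 2) * τ ^ ((7 : ℝ) / 4) := by
    rw [← Real.rpow_add hτ, ← pow_succ', ← Real.rpow_natCast]
    exact Real.rpow_le_rpow_of_exponent_ge hτ hτ1 (by norm_num)
  have e4 : τ * h ^ 4 ≤ τ ^ ((1 : ℝ) / 2) * h ^ ((5 : ℝ) / 2) := by
    have a1 : τ ^ (1 : ℝ) ≤ τ ^ ((1 : ℝ) / 2) :=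
      Real.rpow_le_rpow_of_exponent_ge hτ hτ1 (by norm_num)
    have a2 : h ^ (4 : ℝ) ≤ h ^ ((5 : ℝ) / 2) :=
      Real.rpow_le_rpow_of_exponent_ge hh hh1 (by norm_num)
    rw [Real.rpow_one] at a1
    rw [← Real.rpow_natCast h 4]
    exact mul_le_mul a1 (by exact_mod_cast a2) (by positivity) (by positivity)
  have p := Real.sqrt_nonneg c₂
  set P := τ ^ ((1 : ℝ) / 2) * τ ^ ((7 : ℝ) / 4) with hP
  set Q := τ ^ ((1 : ℝ) / 2) * h ^ ((5 : ℝ) / 2) with hQ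
  have hP0 : 0 ≤ P := by positivity
  have hQ0 : 0 ≤ Q := by positivity
  have := mul_le_mul_of_nonneg_left e3 hCe
  have := mul_le_mul_of_nonneg_left e4 hCe
  have := mul_nonneg p hP0
  rw [mul_add (τ ^ ((1 : ℝ) / 2))]
  nlinarith

lemma rough_rate_le_mesh_power {c₁ τ h : ℝ} (hc₁ : 0 < c₁) (hτ : 0 < τ) (hh : 0 < h)
    (hh1 : h ≤ 1) (hτh : c₁ * τ ≤ h) :
    τ ^ ((1 : ℝ) / 2) * (τ ^ ((7 : ℝ) / 4) + h ^ ((5 : ℝ) / 2))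
      ≤ (1 / c₁) ^ ((1 : ℝ) / 2) * ((1 / c₁) ^ ((7 : ℝ) / 4) + 1) * (√h * (√h * h)) := by
  have hle : τ ≤ 1 / c₁ * h := by
    rw [one_div, inv_mul_eq_div, le_div_iff₀ hc₁]; linarith
  have e1 : τ ^ ((1 : ℝ) / 2) ≤ (1 / c₁) ^ ((1 : ℝ) / 2) * h ^ ((1 : ℝ) / 2) := by
    rw [← Real.mul_rpow (by positivity) hh.le]
    exact Real.rpow_le_rpow hτ.le hle (by norm_num)
  have e2 : τ ^ ((7 : ℝ) / 4) ≤ (1 / c₁) ^ ((7 : ℝ) / 4) * h ^ ((7 : ℝ) / 4) := by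
    rw [← Real.mul_rpow (by positivity) hh.le]
    exact Real.rpow_le_rpow hτ.le hle (by norm_num)
  have e3 : h ^ ((7 : ℝ) / 4) ≤ h ^ ((3 : ℝ) / 2) :=
    Real.rpow_le_rpow_of_exponent_ge hh hh1 (by norm_num)
  have e4 : h ^ ((5 : ℝ) / 2) ≤ h ^ ((3 : ℝ) / 2) :=
    Real.rpow_le_rpow_of_exponent_ge hh hh1 (by norm_num)
  have e5 : h ^ ((3 : ℝ) / 2) = √h * h := by
    rw [Real.sqrt_eq_rpow, ← Real.rpow_add_one hh.ne']; norm_num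
  rw [← Real.sqrt_eq_rpow h] at e1
  rw [e5] at e3 e4
  calc _ ≤ (1 / c₁) ^ ((1 : ℝ) / 2) * √h
        * ((1 / c₁) ^ ((7 : ℝ) / 4) * (√h * h) + √h * h) := by
        gcongr
        exact e2.trans (by gcongr)
    _ ≤ _ := le_of_eq (by ring)

lemma le_sqrt_mul_add_of_sq_le {K E t R y : ℝ} (hK : 0 ≤ K) (hE : 0 ≤ E) (ht : 0 ≤ t)
    (hR : 0 ≤ R) (h : y ^ 2 ≤ K * (E ^ 2 + t ^ 2 * R ^ 2)) : y ≤ √K * (E + t * R) := by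
  refine (abs_le_of_sq_le_sq' ?_ (by positivity)).2
  rw [mul_pow, Real.sq_sqrt hK]
  refine h.trans (mul_le_mul_of_nonneg_left ?_ hK)
  have := mul_nonneg hE (mul_nonneg ht hR)
  linarith [show (E + t * R) ^ 2 = E ^ 2 + t ^ 2 * R ^ 2 + 2 * (E * (t * R)) by ring]

/-- Step 1 (rough estimate) of the two-step error analysis: under the discrete
convergence framework, the a-priori bound `‖Wⁿ − xⁿ‖₂ ≤ τ^{11/4} + h^{7/2}` at time
level `n ≤ N − 1`, and the induced bounds `D̃_h xⁿ ≥ δ₀/2`, `‖D̃_h xⁿ‖_∞ ≤ C* + 1`,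
there are constants `C̃, σ₀ > 0` depending only on the fixed data such that
`‖W^{n+1} − x^{n+1}‖₂ ≤ C̃ τ^{1/2} (τ^{7/4} + h^{5/2})`, and consequently
`‖D_h x^{n+1}‖_∞ ≤ C* + 1`. -/
theorem stmt12
    (m T A B c₁ c₂ b_f B_f δ₀ Cs Cst Ce : ℝ)
    (hm : 1 < m) (hT : 0 < T) (hAB : A < B)
    (hc₁ : 0 < c₁) (hc₁₂ : c₁ ≤ c₂)
    (hbf : 0 < b_f) (hbfBf : b_f ≤ B_f)
    (hδ₀ : 0 < δ₀) (hCs : 0 < Cs) (hCst : 0 < Cst) (hCe : 0 < Ce) :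
    ∃ Ct > 0, ∃ σ₀ > 0,
      ∀ (M : ℕ), 2 ≤ M →
      ∀ (h τ : ℝ), h = (B - A) / M → 0 < τ →
        c₁ * τ ≤ h → h ≤ c₂ * τ → τ ≤ σ₀ → h ≤ σ₀ →
      ∀ (N : ℕ), (N : ℝ) * τ ≤ T →
      ∀ (f₀ : ℝ → ℝ), (∀ s ∈ Set.Icc A B, b_f ≤ f₀ s ∧ f₀ s ≤ B_f) →
      ∀ (x W r : ℕ → ℕ → ℝ),
        -- x⁰, …, x^N ∈ Q
        (∀ n ≤ N, x n 0 = A ∧ x n M = B ∧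
          ∀ i, 1 ≤ i → i ≤ M → x n (i - 1) < x n i) →
        -- W⁰, …, W^N ∈ Q
        (∀ n ≤ N, W n 0 = A ∧ W n M = B ∧
          ∀ i, 1 ≤ i → i ≤ M → W n (i - 1) < W n i) →
        -- (i) the fully discrete scheme for x
        (∀ n < N, ∀ i, 1 ≤ i → i ≤ M - 1 →
          f₀ (A + i * h) / (m * (f₀ (A + i * h) / Dtil M h (x n) i) ^ (m - 1)) *
              ((x (n + 1) i - x n i) / τ)
            = -dh h (fun j => f₀ (A + (j + 1 / 2) * h) / Dh h (x (n + 1)) j) i) →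
        -- (ii) the perturbed scheme for W with residual r
        (∀ n < N, ∀ i, 1 ≤ i → i ≤ M - 1 →
          f₀ (A + i * h) / (m * (f₀ (A + i * h) / Dtil M h (W n) i) ^ (m - 1)) *
              ((W (n + 1) i - W n i) / τ)
            = -dh h (fun j => f₀ (A + (j + 1 / 2) * h) / Dh h (W (n + 1)) j) i + r n i) →
        (∀ n < N, norm2 M h (r n) ≤ Ce * (τ ^ 3 + h ^ 4)) →
        -- (iii) uniform bounds on W
        (∀ n ≤ N, ∀ i ≤ M, δ₀ ≤ Dtil M h (W n) i ∧ |Dtil M h (W n) i| ≤ Cs) →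
        (∀ n ≤ N, ∀ j < M, δ₀ ≤ Dh h (W n) j ∧ |Dh h (W n) j| ≤ Cs) →
        (∀ n < N, ∀ i ≤ M, |(W (n + 1) i - W n i) / τ| ≤ Cst) →
        -- fixed time level n ≤ N − 1 with the a-priori bounds
        ∀ n : ℕ, n + 1 ≤ N →
          norm2 M h (fun i => W n i - x n i) ≤ τ ^ ((11 : ℝ) / 4) + h ^ ((7 : ℝ) / 2) →
          (∀ i ≤ M, δ₀ / 2 ≤ Dtil M h (x n) i ∧ |Dtil M h (x n) i| ≤ Cs + 1) →
          norm2 M h (fun i => W (n + 1) i - x (n + 1) i)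
              ≤ Ct * τ ^ ((1 : ℝ) / 2) * (τ ^ ((7 : ℝ) / 4) + h ^ ((5 : ℝ) / 2)) ∧
          ∀ j < M, |Dh h (x (n + 1)) j| ≤ Cs + 1 := by
  have hm0 : 0 < m := by linarith
  have hd : 0 < δ₀ / 2 := by linarith
  have hBf : 0 < B_f := by linarith
  have hc₂ : 0 < c₂ := by linarith
  obtain ⟨κ, hκ⟩ := exists_weight_lipschitz (D := Cs + 1) hm hbf hbfBf hd
  have hα : 0 < b_f / (m * B_f ^ (m - 1)) * (δ₀ / 2) ^ (m - 1) := by positivity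
  set α := b_f / (m * B_f ^ (m - 1)) * (δ₀ / 2) ^ (m - 1) with hαdef
  set β := B_f / (m * b_f ^ (m - 1)) * (Cs + 1) ^ (m - 1) with hβdef
  set K := 3 * (β ^ 2 + (κ * Cst) ^ 2 / c₁ ^ 2 + 1) / α ^ 2 with hKdef
  have hK : 0 < K := by positivity
  set Ct := √K * (1 + √c₂ + Ce) with hCtdef
  have hCt : 0 < Ct := by positivity
  set P := (1 / c₁) ^ ((1 : ℝ) / 2) * ((1 / c₁) ^ ((7 : ℝ) / 4) + 1) with hPdef
  have hP : 0 < P := by positivity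
  refine ⟨Ct, hCt, min 1 ((1 / (2 * (Ct * P))) ^ 2), by positivity, ?_⟩
  intro M hM h τ hh hτ hc₁τ hc₂τ hτσ hhσ N _ f₀ hf₀ x W r hxQ hWQ hx hW hr hWD hWDh hWt n hn hEn hxD
  have hM0 : (0 : ℝ) < M := by exact_mod_cast (by omega : 0 < M)
  have hhpos : 0 < h := by rw [hh]; exact div_pos (by linarith) hM0
  have hMh : (M : ℝ) * h = B - A := by rw [hh]; field_simp
  have hτ1 : τ ≤ 1 := hτσ.trans (min_le_left _ _)
  have hh1 : h ≤ 1 := hhσ.trans (min_le_left _ _)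
  have hgrid : ∀ t : ℝ, 0 ≤ t → t ≤ M → b_f ≤ f₀ (A + t * h) ∧ f₀ (A + t * h) ≤ B_f := by
    intro t ht htM
    refine hf₀ _ ⟨by nlinarith, ?_⟩
    have := mul_le_mul_of_nonneg_right htM hhpos.le
    linarith
  have hnode : ∀ i ∈ Finset.Ico 1 M, b_f ≤ f₀ (A + i * h) ∧ f₀ (A + i * h) ≤ B_f := by
    intro i hi
    rw [Finset.mem_Ico] at hi
    exact hgrid i (by positivity) (by exact_mod_cast hi.2.le)
  obtain ⟨hx0, hxM, -⟩ := hxQ n (by omega)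
  obtain ⟨hx0', hxM', hxmono⟩ := hxQ (n + 1) hn
  obtain ⟨hW0, hWM, -⟩ := hWQ n (by omega)
  obtain ⟨hW0', hWM', -⟩ := hWQ (n + 1) hn
  have hstep := norm2_sq_step_le (M := M) (by omega) (α := α) (β := β) (κ := κ) (γ := Cst)
    (F := fun j => f₀ (A + (j + 1 / 2) * h))
    (a := fun i => weight m (f₀ (A + i * h)) (Dtil M h (x n) i))
    (b := fun i => weight m (f₀ (A + i * h)) (Dtil M h (W n) i))
    (x := x n) (W := W n) (x' := x (n + 1)) (W' := W (n + 1)) (r := r n)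
    hhpos hτ hc₁ hc₁τ hα
    (by
      intro j hj
      have hj' : (j : ℝ) + 1 ≤ M := by exact_mod_cast hj
      have := hgrid (j + 1 / 2) (by positivity) (by linarith)
      linarith)
    (by
      intro i hi
      obtain ⟨hb, hB⟩ := hnode i hi
      rw [Finset.mem_Ico] at hi
      obtain ⟨h1, h2⟩ := hxD i hi.2.le
      exact ⟨weight_lower hm hbf hb hB hd h1, weight_upper hm hbf hb hB hd h1 (abs_le.1 h2).2⟩)
    (by
      intro i hi
      obtain ⟨hb, hB⟩ := hnode i hi
      rw [Finset.mem_Ico] at hi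
      obtain ⟨h1, h2⟩ := hxD i hi.2.le
      obtain ⟨h3, h4⟩ := hWD n (by omega) i hi.2.le
      exact hκ _ _ _ hb hB (by linarith) (by linarith [(abs_le.1 h4).2]) h1 (abs_le.1 h2).2)
    (by
      intro j hj
      exact div_pos (sub_pos.2 (by simpa using hxmono (j + 1) (by omega) hj)) hhpos)
    (fun j hj => hδ₀.trans_le (hWDh (n + 1) hn j hj).1)
    (hW0.trans hx0.symm) (hWM.trans hxM.symm) (hW0'.trans hx0'.symm) (hWM'.trans hxM'.symm)
    (fun i hi => hWt n (by omega) i (Finset.mem_Ico.1 hi).2.le)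
    (fun i hi => hx n (by omega) i (Finset.mem_Ico.1 hi).1 (by have := Finset.mem_Ico.1 hi; omega))
    (fun i hi => hW n (by omega) i (Finset.mem_Ico.1 hi).1 (by have := Finset.mem_Ico.1 hi; omega))
  have hmain : norm2 M h (fun i => W (n + 1) i - x (n + 1) i)
      ≤ Ct * τ ^ ((1 : ℝ) / 2) * (τ ^ ((7 : ℝ) / 4) + h ^ ((5 : ℝ) / 2)) := by
    have hE0 := norm2_nonneg M h fun i => W n i - x n i
    have hR0 := norm2_nonneg M h (r n)
    have h1 := le_sqrt_mul_add_of_sq_le hK.le hE0 hτ.le hR0 hstep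
    have h2 := (add_le_add hEn (mul_le_mul_of_nonneg_left (hr n (by omega)) hτ.le)).trans
      (rough_rate_bound hCe.le hτ hhpos hτ1 hh1 hc₂τ)
    refine (h1.trans (mul_le_mul_of_nonneg_left h2 (Real.sqrt_nonneg K))).trans_eq ?_
    rw [hCtdef]
    ring
  refine ⟨hmain, fun j hj => ?_⟩
  have hmesh := rough_rate_le_mesh_power hc₁ hτ hhpos hh1 hc₁τ
  have hmain' : norm2 M h (fun i => W (n + 1) i - x (n + 1) i)
      ≤ Ct * (P * (√h * (√h * h))) := by
    refine hmain.trans ?_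
    rw [mul_assoc]
    exact mul_le_mul_of_nonneg_left hmesh hCt.le
  have hs : 0 < √h := Real.sqrt_pos.2 hhpos
  have hDe := abs_Dh_le_of_norm2_le hhpos (by simp [hW0', hx0']) (by simp [hWM', hxM']) hmain' hj
  have hsqrt : √h ≤ 1 / (2 * (Ct * P)) :=
    Real.sqrt_le_iff.2 ⟨by positivity, hhσ.trans (min_le_right _ _)⟩
  have hone : 2 * (Ct * (P * (√h * (√h * h)))) / (√h * h) ≤ 1 := by
    have : 2 * (Ct * (P * (√h * (√h * h)))) / (√h * h) = √h * (2 * (Ct * P)) := by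
      field_simp
    rw [this]
    exact (le_div_iff₀ (by positivity)).1 hsqrt
  rw [Dh_sub] at hDe
  have h1 := abs_le.1 (hDe.trans hone)
  have h2 := abs_le.1 (hWDh (n + 1) hn j hj).2
  rw [abs_le]
  constructor <;> linarith [h1.1, h1.2, h2.1, h2.2]
end
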